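/- If dim_k H(R) = 2, then D^c(R) has Auslander–Reiten triangles, and the AR quiver of D^c(R) has exactly d − 1 components, each isomorphic to Z A_∞ as a stable translation quiver. -/

import Mathlib

/-!
# Preamble: an interface for the derived category of DG modules over a cochain DG algebra

We formalize the setting of the paper "Calabi-Yau categories and Poincaré duality spaces".
Let `k` be a field and `R` a DG algebra over `k` with `R^{<0} = 0`, `R^0 = k`, `R^1 = 0`
and `dim_k R < ∞`.  Since the derived category `D(R)` of DG left-`R`-modules (and the derived
category `D(R^o)` of DG right-`R`-modules) is not available in Mathlib, we axiomatize it: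
`C` (resp. `Co`) is a `k`-linear triangulated category playing the role of `D(R)`
(resp. `D(R^o)`), and a `DGSetup` records the distinguished objects (`R`, `k = R/R^{≥1}`,
the dual `D(R) = Hom_k(R,k)`, ...) and operations used in the paper, together with the
standing assumptions of the paper, expressed in terms of cohomology.  Cohomology is
faithfully encoded via `H^i(M) = Hom_{D(R)}(R, Σ^i M)`, so that e.g. the graded algebra
structure of `H(R)` is the (Yoneda) composition product, and `Ext^i_R(M,N) = Hom_{D(R)}(M, Σ^i N)`.
-/

open CategoryTheory CategoryTheory.Limits CategoryTheory.Pretriangulated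

universe v u

section Preamble

variable (k : Type u) [Field k]
variable (C : Type u) [Category.{v} C] [Preadditive C] [HasZeroObject C] [HasShift C ℤ]
  [∀ n : ℤ, (shiftFunctor C n).Additive] [Pretriangulated C]
  [Linear k C] [HasFiniteBiproducts C] [∀ n : ℤ, Functor.Linear k (shiftFunctor C n)]

/-- The objects finitely built from `R₀` using distinguished triangles, (de)suspensions,
(finite) coproducts and direct summands, i.e. the thick subcategory generated by `R₀`.
For `R₀ = R` this is the class of compact objects, i.e. the subcategory `D^c(R)`. -/
inductive FinitelyBuilt (R₀ : C) : C → Prop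
  | base : FinitelyBuilt R₀ R₀
  | iso {M N : C} : (M ≅ N) → FinitelyBuilt R₀ M → FinitelyBuilt R₀ N
  | shift {M : C} (n : ℤ) : FinitelyBuilt R₀ M → FinitelyBuilt R₀ (M⟦n⟧)
  | cone {X Y Z : C} (f : X ⟶ Y) (g : Y ⟶ Z) (h : Z ⟶ X⟦(1 : ℤ)⟧) :
      (Triangle.mk f g h ∈ distTriang C) → FinitelyBuilt R₀ X → FinitelyBuilt R₀ Y →
      FinitelyBuilt R₀ Z
  | retract {M N : C} (i : N ⟶ M) (r : M ⟶ N) : i ≫ r = 𝟙 N →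
      FinitelyBuilt R₀ M → FinitelyBuilt R₀ N

/-- An Auslander-Reiten triangle `X → Y → Z → ΣX` in the full subcategory of a pretriangulated
category determined by the class of objects `P`: a distinguished triangle with nonzero
connecting map, such that every morphism out of `X` (in the subcategory) which is not a split
monomorphism factors through `f`, and every morphism into `Z` which is not a split epimorphism
factors through `g`. -/
structure IsARTriangle (P : Set C) {X Y Z : C} (f : X ⟶ Y) (g : Y ⟶ Z)
    (h : Z ⟶ X⟦(1 : ℤ)⟧) : Prop where
  memX : X ∈ P
  memY : Y ∈ P
  memZ : Z ∈ P
  dist : Triangle.mk f g h ∈ distTriang C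
  h_ne : h ≠ 0
  fac_left : ∀ N' : C, N' ∈ P → ∀ u : X ⟶ N',
      ¬ (∃ r : N' ⟶ X, u ≫ r = 𝟙 X) → ∃ v : Y ⟶ N', f ≫ v = u
  fac_right : ∀ N' : C, N' ∈ P → ∀ v : N' ⟶ Z,
      ¬ (∃ s : Z ⟶ N', s ≫ v = 𝟙 Z) → ∃ u : N' ⟶ Y, u ≫ g = v

/-- The subcategory of objects `P` has right AR triangles: for every object `Z` of `P` with
local endomorphism ring there is an AR triangle ending in `Z`. -/
def HasRightARTriangles (P : Set C) : Prop :=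
  ∀ Z : C, Z ∈ P → IsLocalRing (End Z) →
    ∃ (X Y : C) (f : X ⟶ Y) (g : Y ⟶ Z) (h : Z ⟶ X⟦(1 : ℤ)⟧), IsARTriangle C P f g h

/-- The subcategory of objects `P` has left AR triangles: for every object `X` of `P` with
local endomorphism ring there is an AR triangle starting in `X`. -/
def HasLeftARTriangles (P : Set C) : Prop :=
  ∀ X : C, X ∈ P → IsLocalRing (End X) →
    ∃ (Y Z : C) (f : X ⟶ Y) (g : Y ⟶ Z) (h : Z ⟶ X⟦(1 : ℤ)⟧), IsARTriangle C P f g h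

/-- The subcategory of objects `P` has AR triangles if it has both right and left ones. -/
def HasARTriangles (P : Set C) : Prop :=
  HasRightARTriangles C P ∧ HasLeftARTriangles C P

/-- An object is indecomposable if it is nonzero and in any direct sum decomposition one
of the summands vanishes. -/
def Indec (M : C) : Prop :=
  ¬ IsZero M ∧ ∀ A B : C, Nonempty (M ≅ A ⊞ B) → IsZero A ∨ IsZero B

/-- An irreducible morphism in the full subcategory of objects `P`: a non-isomorphism such
that in any factorization through an object of `P`, the first factor is a split monomorphism
or the second factor is a split epimorphism. -/
def IrredMor (P : Set C) {M N : C} (f : M ⟶ N) : Prop :=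
  ¬ IsIso f ∧ ∀ L : C, L ∈ P → ∀ (σ : M ⟶ L) (ρ : L ⟶ N), σ ≫ ρ = f →
    (∃ s : N ⟶ L, s ≫ ρ = 𝟙 N) ∨ (∃ r : L ⟶ M, σ ≫ r = 𝟙 M)

/-- The indecomposable objects belonging to the class `P`. -/
abbrev IndecObj (P : Set C) : Type _ := {M : C // M ∈ P ∧ Indec C M}

/-- Isomorphism, as an equivalence relation on the indecomposable objects in `P`. -/
def isoSetoid (P : Set C) : Setoid (IndecObj C P) where
  r M N := Nonempty (M.1 ≅ N.1)
  iseqv := ⟨fun M => ⟨Iso.refl M.1⟩, fun ⟨e⟩ => ⟨e.symm⟩, fun ⟨e⟩ ⟨e'⟩ => ⟨e ≪≫ e'⟩⟩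

/-- The vertices of the AR quiver of the full subcategory of objects `P`: isomorphism
classes of indecomposable objects in `P`. -/
def ARVertex (P : Set C) : Type _ := Quotient (isoSetoid C P)

/-- The vertex of the AR quiver given by an indecomposable object. -/
def vertexOf (P : Set C) (M : IndecObj C P) : ARVertex C P :=
  Quotient.mk (isoSetoid C P) M

/-- There is an arrow `[M] → [N]` in the AR quiver iff there is an irreducible morphism
`M → N` between representatives. -/
def VArrow (P : Set C) (v w : ARVertex C P) : Prop :=
  ∃ (M N : IndecObj C P) (f : M.1 ⟶ N.1),
    IrredMor C P f ∧ vertexOf C P M = v ∧ vertexOf C P N = w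

/-- Two vertices of the AR quiver lie in the same component iff they are connected by a
finite zigzag of arrows. -/
def sameComponent (P : Set C) (v w : ARVertex C P) : Prop :=
  Relation.EqvGen (fun v w => VArrow C P v w ∨ VArrow C P w v) v w

/-- The set of components of the AR quiver of the full subcategory of objects `P`. -/
def ARComponents (P : Set C) : Type _ :=
  Quotient (Relation.EqvGen.setoid (fun v w => VArrow C P v w ∨ VArrow C P w v))

/-- The component of the AR quiver containing a given vertex. -/
def componentOf (P : Set C) (v₀ : ARVertex C P) : Set (ARVertex C P) :=
  {v | sameComponent C P v v₀}

/-- An AR translation for the subcategory of objects `P`: the assignment `N ↦ τN` on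
indecomposable objects given by the left hand end terms of AR triangles.  (The end terms
of an AR triangle determine each other up to isomorphism, so `τ` is well defined up to
isomorphism; accordingly any choice satisfies `iso_congr`.) -/
structure ARTranslation (P : Set C) where
  τ : IndecObj C P → IndecObj C P
  triangle : ∀ N : IndecObj C P, ∃ (Y : C) (f : (τ N).1 ⟶ Y) (g : Y ⟶ N.1)
      (h : N.1 ⟶ ((τ N).1)⟦(1 : ℤ)⟧), IsARTriangle C P f g h
  iso_congr : ∀ M N : IndecObj C P, Nonempty (M.1 ≅ N.1) → Nonempty ((τ M).1 ≅ (τ N).1)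

/-- The vertices of the repetitive quiver `ℤA∞`: pairs `(p, n)`, `p ∈ ℤ`, `n ≥ 1`. -/
abbrev ZAVertex : Type := ℤ × ℕ+

/-- The arrows of `ℤA∞`: `(p, n) → (p, n+1)` and `(p, n+1) → (p-1, n)`. -/
def ZAArrow (v w : ZAVertex) : Prop :=
  (w.1 = v.1 ∧ w.2 = v.2 + 1) ∨ (w.1 = v.1 - 1 ∧ v.2 = w.2 + 1)

/-- The translation of the stable translation quiver `ℤA∞`: `τ(p, n) = (p+1, n)`. -/
def ZATrans (v : ZAVertex) : ZAVertex := (v.1 + 1, v.2)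

/-- A set of vertices (a component) of the AR quiver, with translation `τv`, is isomorphic
to `ℤA∞` as a stable translation quiver: it is stable under the translation and there is a
bijection with the vertices of `ℤA∞` matching arrows with arrows and translation with
translation. -/
def IsZAInftyComponent (P : Set C) (τv : ARVertex C P → ARVertex C P)
    (comp : Set (ARVertex C P)) : Prop :=
  ∃ (hτ : ∀ v ∈ comp, τv v ∈ comp) (θ : comp ≃ ZAVertex),
    (∀ v w : comp, VArrow C P v.1 w.1 ↔ ZAArrow (θ v) (θ w)) ∧
    (∀ v : comp, θ ⟨τv v.1, hτ v.1 v.2⟩ = ZATrans (θ v))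

/-- A functor `F` is a Serre functor for the full subcategory of objects `P` of the `k`-linear
category `C`: it preserves `P` and there are isomorphisms
`Hom_k(Hom(M,N), k) ≅ Hom(N, F M)` natural in `M` and `N`. -/
def IsSerreFunctorOn (P : Set C) (F : C ⥤ C) : Prop :=
  (∀ M : C, M ∈ P → F.obj M ∈ P) ∧
  ∃ η : ∀ M N : C, M ∈ P → N ∈ P → Module.Dual k (M ⟶ N) ≃ₗ[k] (N ⟶ F.obj M),
    (∀ (M N N' : C) (hM : M ∈ P) (hN : N ∈ P) (hN' : N' ∈ P) (g : N' ⟶ N)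
        (ψ : Module.Dual k (M ⟶ N)),
        η M N' hM hN' (ψ.comp (Linear.rightComp k M g)) = g ≫ η M N hM hN ψ) ∧
    (∀ (M M' N : C) (hM : M ∈ P) (hM' : M' ∈ P) (hN : N ∈ P) (f : M ⟶ M')
        (ψ : Module.Dual k (M ⟶ N)),
        η M' N hM' hN (ψ.comp (Linear.leftComp k N f)) = η M N hM hN ψ ≫ F.map f)

/-- The `n`-th power of the suspension is a Serre functor for the subcategory of objects `P`. -/
def IsSerreShift (P : Set C) (n : ℤ) : Prop :=
  IsSerreFunctorOn k C P (shiftFunctor C n)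

/-- The full subcategory of objects `P` is an `n`-Calabi-Yau category: `n` is the smallest
non-negative integer such that `Σ^n` is a Serre functor. -/
def IsCalabiYau (P : Set C) (n : ℤ) : Prop :=
  0 ≤ n ∧ IsSerreShift k C P n ∧ ∀ m : ℤ, 0 ≤ m → m < n → ¬ IsSerreShift k C P m

/-- The full subcategory of objects `P` is a Krull-Schmidt category: every object is a finite
direct sum of objects with local endomorphism rings, and such a decomposition is unique up to
isomorphism and permutation of the summands. -/
def KrullSchmidtClass (P : Set C) : Prop :=
  (∀ M : C, M ∈ P → ∃ (n : ℕ) (Ys : Fin n → C),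
      (∀ j, Ys j ∈ P ∧ IsLocalRing (End (Ys j))) ∧ Nonempty (M ≅ ⨁ Ys)) ∧
  (∀ (n m : ℕ) (Ys : Fin n → C) (Zs : Fin m → C),
      (∀ j, IsLocalRing (End (Ys j))) → (∀ j, IsLocalRing (End (Zs j))) →
      Nonempty ((⨁ Ys) ≅ ⨁ Zs) →
      ∃ σ : Fin n ≃ Fin m, ∀ j, Nonempty (Ys j ≅ Zs (σ j)))

/-- Total finite dimensionality of `Ext(M,N) = ⊕_i Hom(M, Σ^i N)` over `k`. -/
def FinTotalExt (M N : C) : Prop :=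
  (∀ i : ℤ, FiniteDimensional k (M ⟶ N⟦i⟧)) ∧
    Set.Finite {i : ℤ | Nontrivial (M ⟶ N⟦i⟧)}

/-- The composition of a chain of morphisms `⋯ → Ms 2 → Ms 1 → Ms 0`. -/
def chainComp (Ms : ℕ → C) (fs : ∀ i, Ms (i + 1) ⟶ Ms i) : ∀ q, Ms q ⟶ Ms 0
  | 0 => 𝟙 (Ms 0)
  | (q + 1) => fs q ≫ chainComp Ms fs q

end Preamble

section Preamble2

variable {C : Type u} [Category.{v} C] [Preadditive C] [HasZeroObject C] [HasShift C ℤ]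
  [∀ n : ℤ, (shiftFunctor C n).Additive] [Pretriangulated C] [HasFiniteBiproducts C]

/-- The action of the AR translation on the vertices of the AR quiver. -/
def ARTranslation.vmap {P : Set C} (t : ARTranslation C P) :
    ARVertex C P → ARVertex C P :=
  Quotient.map t.τ fun M N h => t.iso_congr M N h

end Preamble2
section Setup

variable (k : Type u) [Field k]
variable (C : Type u) [Category.{v} C] [Preadditive C] [HasZeroObject C] [HasShift C ℤ]
  [∀ n : ℤ, (shiftFunctor C n).Additive] [Pretriangulated C]
  [Linear k C] [HasFiniteBiproducts C] [∀ n : ℤ, Functor.Linear k (shiftFunctor C n)]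
variable (Co : Type u) [Category.{v} Co] [Preadditive Co] [HasZeroObject Co] [HasShift Co ℤ]
  [∀ n : ℤ, (shiftFunctor Co n).Additive] [Pretriangulated Co]
  [Linear k Co] [HasFiniteBiproducts Co] [∀ n : ℤ, Functor.Linear k (shiftFunctor Co n)]

/-- The data of the paper's setting.  `C` plays the role of the derived category `D(R)` of DG
left modules over the cochain DG algebra `R` (with `R^{<0} = 0`, `R^0 = k`, `R^1 = 0` and
`dim_k R < ∞`), and `Co` plays the role of the derived category `D(R^o)` of DG right modules.
The fields record the objects and functors used in the paper, and the axioms record the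
standing assumptions, with cohomology encoded as `H^i(M) = Hom_{D(R)}(R, Σ^i M)`. -/
structure DGSetup where
  /-- the free DG module `R` as an object of `D(R)` -/
  R : C
  /-- the free DG module `R` as an object of `D(R^o)` -/
  Ro : Co
  /-- the DG bi-`R`-module `k = R/R^{≥1}` viewed as an object of `D(R)` -/
  kMod : C
  /-- `k = R/R^{≥1}` viewed as an object of `D(R^o)` -/
  kModo : Co
  /-- the dual `D(R) = Hom_k(R,k)` as a DG left module, i.e. as an object of `D(R)` -/
  DR : C
  /-- the dual `D(R) = Hom_k(R,k)` as a DG right module, i.e. as an object of `D(R^o)` -/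
  DRo : Co
  /-- the DG left module `RHom_{R^o}(D(R), R)` -/
  RHomDRR : C
  /-- the functor `D(R) ⊗^L_R - : D(R) → D(R)`, where the tensor product inherits the
  left `R`-structure from the DG bi-`R`-module `D(R)` -/
  tensDR : C ⥤ C
  /-- the functor `Σ RHom_{R^o}(D(R), R) ⊗^L_R - : D(R) → D(R)` -/
  homDR : C ⥤ C
  /-- the cohomology `H^i(M ⊗^L_R N)` of the derived tensor product of a DG right module
  `M` and a DG left module `N` -/
  Htensor : Co → C → ℤ → ModuleCat.{v} k
  /-- the supremum `d = sup { i | H^i(R) ≠ 0 }` -/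
  d : ℤ
  /-- the dimension `dim_k R` of the underlying DG algebra -/
  dimR : ℕ
  /-- `H^i(R) = 0` for `i < 0` -/
  HR_neg : ∀ i : ℤ, i < 0 → Subsingleton (R ⟶ R⟦i⟧)
  /-- `H^0(R) ≅ k` -/
  HR_zero : Nonempty ((R ⟶ R⟦(0 : ℤ)⟧) ≃ₗ[k] k)
  /-- `H^1(R) = 0` -/
  HR_one : Subsingleton (R ⟶ R⟦(1 : ℤ)⟧)
  /-- `dim_k H(R) < ∞`, degreewise finiteness -/
  HR_findim : ∀ i : ℤ, FiniteDimensional k (R ⟶ R⟦i⟧)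
  /-- `dim_k H(R) < ∞`, boundedness -/
  HR_bdd : Set.Finite {i : ℤ | Nontrivial (R ⟶ R⟦i⟧)}
  /-- `H^i(R) = 0` for `i < 0`, in `D(R^o)` -/
  HRo_neg : ∀ i : ℤ, i < 0 → Subsingleton (Ro ⟶ Ro⟦i⟧)
  /-- `H^0(R) ≅ k`, in `D(R^o)` -/
  HRo_zero : Nonempty ((Ro ⟶ Ro⟦(0 : ℤ)⟧) ≃ₗ[k] k)
  /-- `H^1(R) = 0`, in `D(R^o)` -/
  HRo_one : Subsingleton (Ro ⟶ Ro⟦(1 : ℤ)⟧)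
  /-- `dim_k H(R) < ∞`, degreewise finiteness, in `D(R^o)` -/
  HRo_findim : ∀ i : ℤ, FiniteDimensional k (Ro ⟶ Ro⟦i⟧)
  /-- `dim_k H(R) < ∞`, boundedness, in `D(R^o)` -/
  HRo_bdd : Set.Finite {i : ℤ | Nontrivial (Ro ⟶ Ro⟦i⟧)}
  /-- `H^d(R) ≠ 0` -/
  d_mem : Nontrivial (R ⟶ R⟦d⟧)
  /-- `d` bounds the degrees of the nonvanishing cohomology of `R` -/
  d_greatest : ∀ i : ℤ, Nontrivial (R ⟶ R⟦i⟧) → i ≤ d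
  /-- `H^0(k) ≅ k` -/
  Hk_zero : Nonempty ((R ⟶ kMod⟦(0 : ℤ)⟧) ≃ₗ[k] k)
  /-- `H^i(k) = 0` for `i ≠ 0` -/
  Hk_ne : ∀ i : ℤ, i ≠ 0 → Subsingleton (R ⟶ kMod⟦i⟧)
  /-- `H^0(k) ≅ k`, in `D(R^o)` -/
  Hko_zero : Nonempty ((Ro ⟶ kModo⟦(0 : ℤ)⟧) ≃ₗ[k] k)
  /-- `H^i(k) = 0` for `i ≠ 0`, in `D(R^o)` -/
  Hko_ne : ∀ i : ℤ, i ≠ 0 → Subsingleton (Ro ⟶ kModo⟦i⟧)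
  /-- `R ≠ 0`, so `dim_k R ≥ 1` -/
  dimR_pos : 0 < dimR
  /-- `D(R) ⊗^L_R R ≅ D(R)` -/
  tensDR_R : Nonempty (tensDR.obj R ≅ DR)
  /-- `Σ RHom_{R^o}(D(R), R) ⊗^L_R R ≅ Σ RHom_{R^o}(D(R), R)` -/
  homDR_R : Nonempty (homDR.obj R ≅ RHomDRR⟦(1 : ℤ)⟧)
  /-- `H(R ⊗^L_R N) ≅ H(N)` -/
  Htensor_R : ∀ (N : C) (i : ℤ), Nonempty ((Htensor Ro N i : Type v) ≃ₗ[k] (R ⟶ N⟦i⟧))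
  /-- `H(M ⊗^L_R R) ≅ H(M)` -/
  Htensor_Ro : ∀ (M : Co) (i : ℤ), Nonempty ((Htensor M R i : Type v) ≃ₗ[k] (Ro ⟶ M⟦i⟧))

namespace DGSetup

variable {k C Co}
variable (S : DGSetup k C Co)

/-- The cohomology `H^i(M) = Hom_{D(R)}(R, Σ^i M)` of a DG left module, a `k`-vector space. -/
abbrev H (M : C) (i : ℤ) : Type v := S.R ⟶ M⟦i⟧

/-- The cohomology `H^i(M) = Hom_{D(R^o)}(R, Σ^i M)` of a DG right module. -/
abbrev Ho (M : Co) (i : ℤ) : Type v := S.Ro ⟶ M⟦i⟧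

/-- `M` belongs to `D^f(R)`, the full subcategory of DG modules with `dim_k H(M) < ∞`. -/
def memDf (M : C) : Prop :=
  (∀ i : ℤ, FiniteDimensional k (S.H M i)) ∧ Set.Finite {i : ℤ | Nontrivial (S.H M i)}

/-- `M` belongs to `D^f(R^o)`. -/
def memDfo (M : Co) : Prop :=
  (∀ i : ℤ, FiniteDimensional k (S.Ho M i)) ∧ Set.Finite {i : ℤ | Nontrivial (S.Ho M i)}

/-- `M` belongs to `D^c(R)`, the full subcategory of compact objects, i.e. the objects
finitely built from `R`. -/
def memDc (M : C) : Prop := FinitelyBuilt C S.R M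

/-- `M` belongs to `D^c(R^o)`. -/
def memDco (M : Co) : Prop := FinitelyBuilt Co S.Ro M

/-- `D^f(R)` as a class of objects. -/
def Df : Set C := {M | S.memDf M}

/-- `D^c(R)` as a class of objects. -/
def Dc : Set C := {M | S.memDc M}

/-- `D^f(R^o)` as a class of objects. -/
def Dfo : Set Co := {M | S.memDfo M}

/-- `D^c(R^o)` as a class of objects. -/
def Dco : Set Co := {M | S.memDco M}

/-- The total dimension `dim_k H(R)` of the cohomology of `R`. -/
noncomputable def dimH : Cardinal :=
  Cardinal.sum fun i : ℤ => Module.rank k (S.H S.R i)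

/-- The invariant `φ(M) = dim_k Ext_R(M, k)`, with `Ext^i_R(M,k) = Hom_{D(R)}(M, Σ^i k)`. -/
noncomputable def phi (M : C) : Cardinal :=
  Cardinal.sum fun i : ℤ => Module.rank k (M ⟶ S.kMod⟦i⟧)

/-- `R` is a Gorenstein DG algebra: `D(R) ≅ Σ^d R` in `D(R)` and in `D(R^o)`. -/
def Gorenstein : Prop :=
  Nonempty (S.DR ≅ S.R⟦S.d⟧) ∧ Nonempty (S.DRo ≅ S.Ro⟦S.d⟧)

/-- The left action `H^i(R) × H^j(M) → H^{i+j}(M)` of the cohomology algebra of `R` on the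
cohomology of a DG left module, given by (shifted) composition in `D(R)`. -/
noncomputable def hsmul (M : C) {i j : ℤ} (a : S.H S.R i) (x : S.H M j) : S.H M (i + j) :=
  a ≫ (shiftFunctor C i).map x ≫ (shiftFunctorAdd' C j i (i + j) (by omega)).inv.app M

/-- The product on the cohomology algebra `H(R)`, given by composition in `D(R)`. -/
noncomputable def hmul {i j : ℤ} (a : S.H S.R i) (x : S.H S.R j) : S.H S.R (i + j) :=
  S.hsmul S.R a x

/-- Transport of cohomology along an equality of degrees. -/
def hcast (M : C) {i j : ℤ} (h : i = j) : S.H M i →ₗ[k] S.H M j := by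
  subst h; exact LinearMap.id

/-- Right multiplication `x ↦ x · a` on the cohomology algebra, as a linear map. -/
noncomputable def mulRight {m i : ℤ} (a : S.H S.R i) : S.H S.R m →ₗ[k] S.H S.R (m + i) :=
  Linear.rightComp k S.R
    ((shiftFunctor C m).map a ≫ (shiftFunctorAdd' C i m (m + i) (by omega)).inv.app S.R)

/-- Left multiplication `x ↦ a · x` on the cohomology algebra, as a linear map. -/
noncomputable def mulLeft {i m : ℤ} (a : S.H S.R i) : S.H S.R m →ₗ[k] S.H S.R (i + m) :=
  (Linear.rightComp k S.R ((shiftFunctorAdd' C m i (i + m) (by omega)).inv.app S.R)).comp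
    (((Linear.leftComp k ((S.R⟦m⟧)⟦i⟧) a).comp ((shiftFunctor C i).mapLinearMap k)))

/-- There is an isomorphism `D(H(R)) ≅ Σ^n H(R)` of graded left `H(R)`-modules, where
`D(-) = Hom_k(-, k)`: in degree `j` an isomorphism `Hom_k(H^{n-j}(R), k) ≅ H^j(R)`,
compatible with the left action of `H(R)` (the action on the dual being induced by right
multiplication). -/
def dualIsoShiftLeft (n : ℤ) : Prop :=
  ∃ e : ∀ j : ℤ, Module.Dual k (S.H S.R (n - j)) ≃ₗ[k] S.H S.R j,
    ∀ (i j : ℤ) (a : S.H S.R i) (f : Module.Dual k (S.H S.R (n - j))),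
      e (i + j) (f.comp ((S.hcast S.R (show n - (i + j) + i = n - j by omega)).comp
        (S.mulRight a))) = S.hmul a (e j f)

/-- There is an isomorphism `D(H(R)) ≅ Σ^n H(R)` of graded right `H(R)`-modules. -/
def dualIsoShiftRight (n : ℤ) : Prop :=
  ∃ e : ∀ j : ℤ, Module.Dual k (S.H S.R (n - j)) ≃ₗ[k] S.H S.R j,
    ∀ (i j : ℤ) (a : S.H S.R i) (f : Module.Dual k (S.H S.R (n - j))),
      e (j + i) (f.comp ((S.hcast S.R (show i + (n - (j + i)) = n - j by omega)).comp
        (S.mulLeft a))) = S.hmul (e j f) a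

end DGSetup

end Setup

set_option linter.unusedSectionVars false

section HomCalculus

variable {k : Type u} [Field k]
variable {C : Type u} [Category.{v} C] [Preadditive C] [HasZeroObject C] [HasShift C ℤ]
  [∀ n : ℤ, (shiftFunctor C n).Additive] [Pretriangulated C]
  [Linear k C] [HasFiniteBiproducts C] [∀ n : ℤ, Functor.Linear k (shiftFunctor C n)]

/-- The isomorphism `M⟦i⟧⟦j⟧ ≅ M⟦l⟧` for `i + j = l`. -/
def shiftShiftIso (M : C) {i j l : ℤ} (h : i + j = l) : (M⟦i⟧)⟦j⟧ ≅ M⟦l⟧ :=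
  ((shiftFunctorAdd' C i j l h).app M).symm

/-- The isomorphism `M⟦0⟧ ≅ M`. -/
def shiftZeroIso (M : C) : M⟦(0 : ℤ)⟧ ≅ M := (shiftFunctorZero C ℤ).app M

/-- The isomorphism `M⟦i⟧⟦j⟧ ≅ M` for `i + j = 0`. -/
def shiftShiftNegIso (M : C) {i j : ℤ} (h : i + j = 0) : (M⟦i⟧)⟦j⟧ ≅ M :=
  shiftShiftIso M h ≪≫ shiftZeroIso M

/-- The isomorphism induced by a shift functor on `Hom`. -/
noncomputable def shiftHomEquiv (k : Type u) [Field k] [Linear k C]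
    [∀ n : ℤ, Functor.Linear k (shiftFunctor C n)] (A B : C) (n : ℤ) :
    (A ⟶ B) ≃ₗ[k] (A⟦n⟧ ⟶ B⟦n⟧) :=
  LinearEquiv.ofBijective ((shiftFunctor C n).mapLinearMap k)
    ⟨fun _ _ h => (shiftFunctor C n).map_injective h, fun f =>
      ⟨(shiftFunctor C n).preimage f, (shiftFunctor C n).map_preimage f⟩⟩

theorem shift_map_ne_zero {A B : C} {f : A ⟶ B} (hf : f ≠ 0) (n : ℤ) : f⟦n⟧' ≠ 0 := by
  intro h
  apply hf
  apply (shiftFunctor C n).map_injective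
  rw [h, Functor.map_zero]

/-- There is no nonzero morphism `A ⟶ B`. -/
def HomZero (A B : C) : Prop := ∀ f : A ⟶ B, f = 0

theorem HomZero.shift {A B A' B' : C} (H : HomZero A B) (n : ℤ) (e : A⟦n⟧ ≅ A')
    (e' : B⟦n⟧ ≅ B') : HomZero A' B' := by
  intro f
  obtain ⟨g, hg⟩ := (shiftFunctor C n).map_surjective (e.hom ≫ f ≫ e'.inv)
  rw [H g, Functor.map_zero] at hg
  have : f = e.inv ≫ (e.hom ≫ f ≫ e'.inv) ≫ e'.hom := by simp
  rw [this, ← hg]; simp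

theorem HomZero.congr {A B A' B' : C} (H : HomZero A B) (e : A ≅ A')
    (e' : B ≅ B') : HomZero A' B' :=
  H.shift 0 (shiftZeroIso A ≪≫ e) (shiftZeroIso B ≪≫ e')

theorem HomZero.shift_shift {A B : C} {i j i' j' : ℤ} (H : HomZero (A⟦i⟧) (B⟦j⟧))
    (h : i' - i = j' - j) : HomZero (A⟦i'⟧) (B⟦j'⟧) :=
  H.shift (i' - i) (shiftShiftIso A (by omega)) (shiftShiftIso B (by omega))

theorem HomZero.shift_right {A B : C} {i i' j' : ℤ} (H : HomZero (A⟦i⟧) B)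
    (h : i' - i = j') : HomZero (A⟦i'⟧) (B⟦j'⟧) :=
  (H.congr (Iso.refl _) (shiftZeroIso B).symm).shift_shift (by omega)

theorem HomZero.unshift_right {A B : C} {i i' j' : ℤ} (H : HomZero (A⟦i'⟧) (B⟦j'⟧))
    (h : i' - i = j') : HomZero (A⟦i⟧) B :=
  (H.shift_shift (i' := i) (j' := 0) (by omega)).congr (Iso.refl _) (shiftZeroIso B)

/-- Composites of nonzero morphisms `A ⟶ B ⟶ D` are nonzero. -/
def CompNeZero (A B D : C) : Prop := ∀ (p : A ⟶ B) (q : B ⟶ D), p ≠ 0 → q ≠ 0 → p ≫ q ≠ 0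

theorem CompNeZero.shift {A B D A' B' D' : C} (H : CompNeZero A B D) (n : ℤ) (e : A⟦n⟧ ≅ A')
    (e' : B⟦n⟧ ≅ B') (e'' : D⟦n⟧ ≅ D') : CompNeZero A' B' D' := by
  intro p q hp hq h
  obtain ⟨p', hp'⟩ := (shiftFunctor C n).map_surjective (e.hom ≫ p ≫ e'.inv)
  obtain ⟨q', hq'⟩ := (shiftFunctor C n).map_surjective (e'.hom ≫ q ≫ e''.inv)
  refine H p' q' ?_ ?_ ?_
  · rintro rfl
    rw [Functor.map_zero] at hp'
    apply hp
    have : p = e.inv ≫ (e.hom ≫ p ≫ e'.inv) ≫ e'.hom := by simp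
    rw [this, ← hp']; simp
  · rintro rfl
    rw [Functor.map_zero] at hq'
    apply hq
    have : q = e'.inv ≫ (e'.hom ≫ q ≫ e''.inv) ≫ e''.hom := by simp
    rw [this, ← hq']; simp
  · apply (shiftFunctor C n).map_injective
    rw [Functor.map_comp, hp', hq']
    have : (e.hom ≫ p ≫ e'.inv) ≫ e'.hom ≫ q ≫ e''.inv = e.hom ≫ (p ≫ q) ≫ e''.inv := by simp
    rw [this, h]; simp

/-- Every nonzero `u : N ⟶ W` is detected by some `v : X ⟶ N`. -/
def DetectLeft (N X W : C) : Prop := ∀ u : N ⟶ W, u ≠ 0 → ∃ v : X ⟶ N, v ≫ u ≠ 0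

/-- Every nonzero `v : X ⟶ N` is detected by some `u : N ⟶ W`. -/
def DetectRight (N X W : C) : Prop := ∀ v : X ⟶ N, v ≠ 0 → ∃ u : N ⟶ W, v ≫ u ≠ 0

theorem DetectLeft.shift {A B D A' B' D' : C} (H : DetectLeft A B D) (n : ℤ) (e : A⟦n⟧ ≅ A')
    (e' : B⟦n⟧ ≅ B') (e'' : D⟦n⟧ ≅ D') : DetectLeft A' B' D' := by
  intro u hu
  obtain ⟨u', hu'⟩ := (shiftFunctor C n).map_surjective (e.hom ≫ u ≫ e''.inv)
  have hu0 : u' ≠ 0 := by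
    rintro rfl
    rw [Functor.map_zero] at hu'
    apply hu
    have : u = e.inv ≫ (e.hom ≫ u ≫ e''.inv) ≫ e''.hom := by simp
    rw [this, ← hu']; simp
  obtain ⟨v, hv⟩ := H u' hu0
  refine ⟨e'.inv ≫ v⟦n⟧' ≫ e.hom, fun h => shift_map_ne_zero hv n ?_⟩
  rw [Functor.map_comp, hu']
  have : v⟦n⟧' ≫ e.hom ≫ u ≫ e''.inv = e'.hom ≫ ((e'.inv ≫ v⟦n⟧' ≫ e.hom) ≫ u) ≫ e''.inv := by
    simp
  rw [this, h]; simp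

theorem DetectRight.shift {A B D A' B' D' : C} (H : DetectRight A B D) (n : ℤ) (e : A⟦n⟧ ≅ A')
    (e' : B⟦n⟧ ≅ B') (e'' : D⟦n⟧ ≅ D') : DetectRight A' B' D' := by
  intro u hu
  obtain ⟨u', hu'⟩ := (shiftFunctor C n).map_surjective (e'.hom ≫ u ≫ e.inv)
  have hu0 : u' ≠ 0 := by
    rintro rfl
    rw [Functor.map_zero] at hu'
    apply hu
    have : u = e'.inv ≫ (e'.hom ≫ u ≫ e.inv) ≫ e.hom := by simp
    rw [this, ← hu']; simp
  obtain ⟨v, hv⟩ := H u' hu0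
  refine ⟨e.inv ≫ v⟦n⟧' ≫ e''.hom, fun h => shift_map_ne_zero hv n ?_⟩
  rw [Functor.map_comp, hu']
  have : (e'.hom ≫ u ≫ e.inv) ≫ v⟦n⟧' = e'.hom ≫ (u ≫ (e.inv ≫ v⟦n⟧' ≫ e''.hom)) ≫ e''.inv := by
    simp
  rw [this, h]; simp

/-- Any nonzero morphism `A ⟶ B` spans `Hom(A, B)`. -/
def HomLine (k : Type u) [Field k] [Linear k C] (A B : C) : Prop :=
  ∀ f g : A ⟶ B, g ≠ 0 → ∃ c : k, f = c • g

theorem HomLine.shift {A B A' B' : C} (H : HomLine k A B) (n : ℤ) (e : A⟦n⟧ ≅ A')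
    (e' : B⟦n⟧ ≅ B') : HomLine k A' B' := by
  intro f g hg
  let E := (shiftHomEquiv k A B n).trans (Linear.homCongr k e e')
  obtain ⟨f, rfl⟩ := E.surjective f
  obtain ⟨g, rfl⟩ := E.surjective g
  obtain ⟨c, rfl⟩ := H f g (by rintro rfl; simp at hg)
  exact ⟨c, by simp⟩

theorem HomLine.of_finrank {A B : C} (h : Module.finrank k (A ⟶ B) = 1) : HomLine k A B := by
  intro f g hg
  obtain ⟨c, hc⟩ := (finrank_eq_one_iff_of_nonzero' g hg).1 h f
  exact ⟨c, hc.symm⟩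

theorem HomLine.finrank {A B : C} (H : HomLine k A B) {g : A ⟶ B} (hg : g ≠ 0) :
    Module.finrank k (A ⟶ B) = 1 :=
  (finrank_eq_one_iff_of_nonzero' g hg).2 fun f => (H f g hg).imp fun _ h => h.symm

theorem dist_units_smul {X Y Z : C} {f : X ⟶ Y} {g : Y ⟶ Z} {h : Z ⟶ X⟦(1 : ℤ)⟧} (ε : ℤˣ)
    (T : Triangle.mk (ε • f) (ε • g) h ∈ distTriang C) : Triangle.mk f g h ∈ distTriang C := by
  rcases Int.units_eq_one_or ε with rfl | rfl
  · simpa using T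
  · refine isomorphic_distinguished _ T _
      (Triangle.isoMk _ _ (Iso.refl _) ⟨-𝟙 Y, -𝟙 Y, ?_, ?_⟩ (Iso.refl _) ?_ ?_ ?_)
    · exact (Preadditive.neg_comp_neg _ _).trans (Category.comp_id _)
    · exact (Preadditive.neg_comp_neg _ _).trans (Category.comp_id _)
    · change f ≫ (-𝟙 Y) = 𝟙 X ≫ ((-1 : ℤˣ) • f)
      simp
    · change g ≫ 𝟙 Z = (-𝟙 Y) ≫ ((-1 : ℤˣ) • g)
      simp
    · change h ≫ (𝟙 X)⟦(1 : ℤ)⟧' = 𝟙 Z ≫ h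
      simp

theorem dist_shift {X Y Z : C} {f : X ⟶ Y} {g : Y ⟶ Z} {h : Z ⟶ X⟦(1 : ℤ)⟧}
    (T : Triangle.mk f g h ∈ distTriang C) (n : ℤ) :
    ∃ h' : Z⟦n⟧ ⟶ (X⟦n⟧)⟦(1 : ℤ)⟧, Triangle.mk (f⟦n⟧') (g⟦n⟧') h' ∈ distTriang C :=
  ⟨_, dist_units_smul n.negOnePow (Triangle.shift_distinguished _ T n)⟩

theorem exact_two {X Y Z : C} {f : X ⟶ Y} {g : Y ⟶ Z} {h : Z ⟶ X⟦(1 : ℤ)⟧}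
    (T : Triangle.mk f g h ∈ distTriang C) {A : C} (u : A ⟶ Y) (hu : u ≫ g = 0) :
    ∃ w : A ⟶ X, u = w ≫ f := Triangle.coyoneda_exact₂ _ T u hu

theorem exact_three {X Y Z : C} {f : X ⟶ Y} {g : Y ⟶ Z} {h : Z ⟶ X⟦(1 : ℤ)⟧}
    (T : Triangle.mk f g h ∈ distTriang C) {A : C} (u : A ⟶ Z) (hu : u ≫ h = 0) :
    ∃ w : A ⟶ Y, u = w ≫ g := Triangle.coyoneda_exact₃ _ T u hu

theorem exact_one {X Y Z : C} {f : X ⟶ Y} {g : Y ⟶ Z} {h : Z ⟶ X⟦(1 : ℤ)⟧}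
    (T : Triangle.mk f g h ∈ distTriang C) {A : C} (u : A ⟶ X⟦(1 : ℤ)⟧) (hu : u ≫ f⟦(1 : ℤ)⟧' = 0) :
    ∃ w : A ⟶ Z, u = w ≫ h := Triangle.coyoneda_exact₁ _ T u hu

theorem coexact_two {X Y Z : C} {f : X ⟶ Y} {g : Y ⟶ Z} {h : Z ⟶ X⟦(1 : ℤ)⟧}
    (T : Triangle.mk f g h ∈ distTriang C) {A : C} (u : Y ⟶ A) (hu : f ≫ u = 0) :
    ∃ w : Z ⟶ A, u = g ≫ w := Triangle.yoneda_exact₂ _ T u hu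

theorem coexact_three {X Y Z : C} {f : X ⟶ Y} {g : Y ⟶ Z} {h : Z ⟶ X⟦(1 : ℤ)⟧}
    (T : Triangle.mk f g h ∈ distTriang C) {A : C} (u : Z ⟶ A) (hu : g ≫ u = 0) :
    ∃ w : X⟦(1 : ℤ)⟧ ⟶ A, u = h ≫ w := Triangle.yoneda_exact₃ _ T u hu

theorem exact_two_shift {X Y Z : C} {f : X ⟶ Y} {g : Y ⟶ Z} {h : Z ⟶ X⟦(1 : ℤ)⟧}
    (T : Triangle.mk f g h ∈ distTriang C) (n : ℤ) {A : C} (u : A ⟶ Y⟦n⟧) (hu : u ≫ g⟦n⟧' = 0) :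
    ∃ w : A ⟶ X⟦n⟧, u = w ≫ f⟦n⟧' := by
  obtain ⟨h', T'⟩ := dist_shift T n
  exact exact_two T' u hu

theorem coexact_one {X Y Z : C} {f : X ⟶ Y} {g : Y ⟶ Z} {h : Z ⟶ X⟦(1 : ℤ)⟧}
    (T : Triangle.mk f g h ∈ distTriang C) {A : C} (u : X ⟶ A) (hu : h ≫ u⟦(1 : ℤ)⟧' = 0) :
    ∃ w : Y ⟶ A, u = f ≫ w := by
  obtain ⟨w, hw⟩ : ∃ w : Y⟦(1 : ℤ)⟧ ⟶ A⟦(1 : ℤ)⟧, u⟦(1 : ℤ)⟧' = (-f⟦(1 : ℤ)⟧') ≫ w :=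
    coexact_three (rot_of_distTriang _ T) (u⟦(1 : ℤ)⟧') hu
  obtain ⟨w', rfl⟩ := (shiftFunctor C (1 : ℤ)).map_surjective w
  refine ⟨-w', (shiftFunctor C (1 : ℤ)).map_injective ?_⟩
  simp [hw]

theorem comp_zero₁₂ {X Y Z : C} {f : X ⟶ Y} {g : Y ⟶ Z} {h : Z ⟶ X⟦(1 : ℤ)⟧}
    (T : Triangle.mk f g h ∈ distTriang C) : f ≫ g = 0 := comp_distTriang_mor_zero₁₂ _ T

theorem comp_zero₂₃ {X Y Z : C} {f : X ⟶ Y} {g : Y ⟶ Z} {h : Z ⟶ X⟦(1 : ℤ)⟧}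
    (T : Triangle.mk f g h ∈ distTriang C) : g ≫ h = 0 := comp_distTriang_mor_zero₂₃ _ T

theorem comp_zero₃₁ {X Y Z : C} {f : X ⟶ Y} {g : Y ⟶ Z} {h : Z ⟶ X⟦(1 : ℤ)⟧}
    (T : Triangle.mk f g h ∈ distTriang C) : h ≫ f⟦(1 : ℤ)⟧' = 0 :=
  comp_distTriang_mor_zero₃₁ _ T

namespace FinitelyBuilt

theorem extension {R X Y Z : C} {f : X ⟶ Y} {g : Y ⟶ Z} {h : Z ⟶ X⟦(1 : ℤ)⟧}
    (T : Triangle.mk f g h ∈ distTriang C) (hX : FinitelyBuilt C R X)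
    (hZ : FinitelyBuilt C R Z) : FinitelyBuilt C R Y :=
  cone _ _ _ (inv_rot_of_distTriang _ T) (shift (-1) hZ) hX

theorem biprod {R X Y : C} (hX : FinitelyBuilt C R X) (hY : FinitelyBuilt C R Y) :
    FinitelyBuilt C R (X ⊞ Y) :=
  extension (binaryBiproductTriangle_distinguished X Y) hX hY

end FinitelyBuilt

end HomCalculus

section Compact

variable {k : Type u} [Field k]
variable {C : Type u} [Category.{v} C] [Preadditive C] [HasZeroObject C] [HasShift C ℤ]
  [∀ n : ℤ, (shiftFunctor C n).Additive] [Pretriangulated C]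
  [Linear k C] [HasFiniteBiproducts C] [∀ n : ℤ, Functor.Linear k (shiftFunctor C n)]

/-- An induction principle for objects finitely built from `R`. -/
@[elab_as_elim]
theorem FinitelyBuilt.induction_shift {R : C} {P : C → Prop} {M : C}
    (hM : FinitelyBuilt C R M) (base : ∀ j : ℤ, P (R⟦j⟧))
    (cone : ∀ {X Y Z : C} (f : X ⟶ Y) (g : Y ⟶ Z) (h : Z ⟶ X⟦(1 : ℤ)⟧),
      Triangle.mk f g h ∈ distTriang C → P X → P Y → P (X⟦(1 : ℤ)⟧) → P (Y⟦(1 : ℤ)⟧) → P Z)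
    (retract : ∀ {M N : C} (i : N ⟶ M) (r : M ⟶ N), i ≫ r = 𝟙 N → P M → P N) : P M := by
  have iso : ∀ {M N : C}, (M ≅ N) → P M → P N := fun e => retract e.inv e.hom (by simp)
  suffices H : ∀ j : ℤ, P (M⟦j⟧) from iso (shiftZeroIso M) (H 0)
  induction hM with
  | base => exact base
  | iso e _ ih => exact fun j => iso ((shiftFunctor C j).mapIso e) (ih j)
  | shift n _ ih => exact fun j => iso (shiftShiftIso _ rfl).symm (ih (n + j))
  | cone f g h T _ _ ihX ihY =>
    intro j
    obtain ⟨h', T'⟩ := dist_shift T j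
    exact cone _ _ _ T' (ihX j) (ihY j) (iso (shiftShiftIso _ rfl).symm (ihX (j + 1)))
      (iso (shiftShiftIso _ rfl).symm (ihY (j + 1)))
  | retract i r h _ ih =>
    exact fun j => retract (i⟦j⟧') (r⟦j⟧') (by rw [← Functor.map_comp, h, CategoryTheory.Functor.map_id]) (ih j)

theorem finiteDimensional_hom_cone {X Y Z : C} {f : X ⟶ Y} {g : Y ⟶ Z} {h : Z ⟶ X⟦(1 : ℤ)⟧}
    (T : Triangle.mk f g h ∈ distTriang C) (A : C) [FiniteDimensional k (A ⟶ Y)]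
    [FiniteDimensional k (A ⟶ X⟦(1 : ℤ)⟧)] : FiniteDimensional k (A ⟶ Z) := by
  have : LinearMap.ker (Linear.rightComp k A h) ≤ LinearMap.range (Linear.rightComp k A g) := by
    intro u hu
    obtain ⟨w, rfl⟩ := exact_three T u hu
    exact ⟨w, rfl⟩
  have := Submodule.finiteDimensional_of_le this
  have := Module.Finite.equiv (LinearMap.quotKerEquivRange (Linear.rightComp k A h)).symm
  exact Module.Finite.of_submodule_quotient (LinearMap.ker (Linear.rightComp k A h))

theorem FinitelyBuilt.finiteDimensional_hom {R M : C} (hR : ∀ j : ℤ, FiniteDimensional k (R ⟶ R⟦j⟧))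
    (hM : FinitelyBuilt C R M) : FiniteDimensional k (R ⟶ M) := by
  refine hM.induction_shift hR ?_ ?_
  · intro X Y Z f g h T _ _ _ _
    exact finiteDimensional_hom_cone T R
  · intro M N i r h _
    refine Module.Finite.of_surjective (Linear.rightComp k R r) fun u => ⟨u ≫ i, ?_⟩
    simp [h]

theorem FinitelyBuilt.bounded {R M : C} (hR : ∃ q : ℤ, ∀ i ≥ q, HomZero (R⟦i⟧) R)
    (hM : FinitelyBuilt C R M) : ∃ q : ℤ, ∀ i ≥ q, HomZero (R⟦i⟧) M := by
  refine hM.induction_shift ?_ ?_ ?_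
  · intro j
    obtain ⟨q, hq⟩ := hR
    exact ⟨q + j, fun i hi => (hq (i - j) (by omega)).shift_right (by omega)⟩
  · intro X Y Z f g h T _ ⟨q, hq⟩ ⟨q', hq'⟩ _
    refine ⟨max q q', fun i hi u => ?_⟩
    obtain ⟨w, rfl⟩ := exact_three T u (hq' i (by omega) _)
    rw [hq i (by omega) w, zero_comp]
  · intro M N i r h ⟨q, hq⟩
    refine ⟨q, fun j hj u => ?_⟩
    rw [← Category.comp_id u, ← h, ← Category.assoc, hq j hj (u ≫ i), zero_comp]

theorem FinitelyBuilt.compact {R M : C} (hM : FinitelyBuilt C R M) :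
    ∃ q : ℤ, ∀ L : C, (∀ i ≥ q, HomZero (R⟦i⟧) L) → HomZero M L := by
  refine hM.induction_shift ?_ ?_ ?_
  · exact fun j => ⟨j, fun L hL => hL j le_rfl⟩
  · intro X Y Z f g h T _ ⟨q, hq⟩ ⟨q', hq'⟩ _
    refine ⟨min q q', fun L hL u => ?_⟩
    obtain ⟨w, rfl⟩ := coexact_three T u (hq L (fun i hi => hL i (by omega)) _)
    rw [hq' L (fun i hi => hL i (by omega)) w, comp_zero]
  · intro M N i r h ⟨q, hq⟩
    refine ⟨q, fun L hL u => ?_⟩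
    rw [← Category.id_comp u, ← h, Category.assoc, hq L hL (r ≫ u), comp_zero]

/-- The map `Hom(N, W) → Hom(X, N)^*` induced by a functional on `Hom(X, W)`. -/
def serreMap {X W : C} (t : (X ⟶ W) →ₗ[k] k) (N : C) : (N ⟶ W) →ₗ[k] Module.Dual k (X ⟶ N) where
  toFun u := t.comp (Linear.rightComp k X u)
  map_add' u u' := by ext v; simp
  map_smul' c u := by ext v; simp

@[simp]
theorem serreMap_apply {X W N : C} (t : (X ⟶ W) →ₗ[k] k) (u : N ⟶ W) (v : X ⟶ N) :
    serreMap t N u v = t (v ≫ u) := rfl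

theorem exists_dual_comp_eq {V V' : Type*} [AddCommGroup V] [Module k V] [AddCommGroup V']
    [Module k V'] (φ : Module.Dual k V) (L : V →ₗ[k] V') (h : ∀ x, L x = 0 → φ x = 0) :
    ∃ ψ : Module.Dual k V', ∀ x, φ x = ψ (L x) := by
  have : φ ∈ LinearMap.range L.dualMap := by
    rw [LinearMap.range_dualMap_eq_dualAnnihilator_ker]
    exact (Submodule.mem_dualAnnihilator φ).2 fun x hx => h x hx
  obtain ⟨ψ, rfl⟩ := this
  exact ⟨ψ, fun _ => rfl⟩

theorem serreMap_bijective {R X W N : C} (t : (X ⟶ W) →ₗ[k] k)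
    (base : ∀ j : ℤ, Function.Bijective (serreMap t (R⟦j⟧))) (hN : FinitelyBuilt C R N) :
    Function.Bijective (serreMap t N) := by
  have key : ∀ (N : C), Function.Injective (serreMap t N) → ∀ u : N ⟶ W,
      (∀ v : X ⟶ N, t (v ≫ u) = 0) → u = 0 := by
    intro N h u hu
    apply h
    ext v
    simpa using hu v
  refine hN.induction_shift base ?_ ?_
  · intro X₀ Y₀ Z₀ f g h T hX hY hX' hY'
    constructor
    · refine (injective_iff_map_eq_zero _).2 fun u hu => ?_
      have hu' : ∀ v : X ⟶ Z₀, t (v ≫ u) = 0 := fun v => LinearMap.congr_fun hu v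
      obtain ⟨w, rfl⟩ := coexact_three T u
        (key _ hY.1 _ fun v => by simpa using hu' (v ≫ g))
      obtain ⟨φ, hφ⟩ := exists_dual_comp_eq (serreMap t _ w) (Linear.rightComp k X (f⟦(1 : ℤ)⟧'))
        (by
          intro x hx
          obtain ⟨z, rfl⟩ := exact_one T x hx
          simpa using hu' z)
      obtain ⟨w', rfl⟩ := hY'.2 φ
      have : w - f⟦(1 : ℤ)⟧' ≫ w' = 0 := key _ hX'.1 _ fun v => by
        have := hφ v
        simp only [serreMap_apply, Linear.rightComp_apply, Category.assoc] at this
        rw [Preadditive.comp_sub, map_sub, this, sub_self]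
      rw [sub_eq_zero.1 this, ← Category.assoc, comp_zero₃₁ T, zero_comp]
    · intro φ
      obtain ⟨y, hy⟩ := hY.2 (φ.comp (Linear.rightComp k X g))
      have hy' : ∀ v : X ⟶ Y₀, t (v ≫ y) = φ (v ≫ g) := fun v => LinearMap.congr_fun hy v
      obtain ⟨u, rfl⟩ := coexact_two T y (key _ hX.1 _ fun v => by
        rw [← Category.assoc, hy', Category.assoc, comp_zero₁₂ T, comp_zero, map_zero])
      obtain ⟨ψ, hψ⟩ := exists_dual_comp_eq (φ - serreMap t _ u) (Linear.rightComp k X h)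
        (by
          intro x hx
          obtain ⟨z, rfl⟩ := exact_three T x hx
          simp [← hy' z])
      obtain ⟨w, rfl⟩ := hX'.2 ψ
      refine ⟨u + h ≫ w, ?_⟩
      ext v
      have := hψ v
      simp only [LinearMap.sub_apply, serreMap_apply, Linear.rightComp_apply,
        Category.assoc] at this
      simp [← this]
  · intro M N i r h hM
    constructor
    · refine (injective_iff_map_eq_zero _).2 fun u hu => ?_
      have hu' : ∀ v : X ⟶ N, t (v ≫ u) = 0 := fun v => LinearMap.congr_fun hu v
      have : r ≫ u = 0 := key _ hM.1 _ fun v => by simpa using hu' (v ≫ r)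
      rw [← Category.id_comp u, ← h, Category.assoc, this, comp_zero]
    · intro φ
      obtain ⟨m, hm⟩ := hM.2 (φ.comp (Linear.rightComp k X r))
      refine ⟨i ≫ m, ?_⟩
      ext v
      have : t ((v ≫ i) ≫ m) = φ ((v ≫ i) ≫ r) := LinearMap.congr_fun hm (v ≫ i)
      simpa [h] using this

theorem serreMap_bijective_of_detectLeft {X W N : C} {t : (X ⟶ W) →ₗ[k] k}
    (ht : ∀ x, t x = 0 → x = 0) (hN : DetectLeft N X W) [FiniteDimensional k (X ⟶ N)]
    [FiniteDimensional k (N ⟶ W)]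
    (h : Module.finrank k (N ⟶ W) = Module.finrank k (X ⟶ N)) :
    Function.Bijective (serreMap t N) := by
  have inj : Function.Injective (serreMap t N) := by
    refine (injective_iff_map_eq_zero _).2 fun u hu => ?_
    by_contra hu0
    obtain ⟨v, hv⟩ := hN u hu0
    exact hv (ht _ (LinearMap.congr_fun hu v))
  exact ⟨inj, (LinearMap.injective_iff_surjective_of_finrank_eq_finrank
    (h.trans Subspace.dual_finrank_eq.symm)).1 inj⟩

theorem detectLeft_of_serreMap {X W N : C} {t : (X ⟶ W) →ₗ[k] k}
    (h : Function.Bijective (serreMap t N)) : DetectLeft N X W := by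
  intro u hu
  by_contra! H
  apply hu
  apply h.1
  ext v
  simp [H v]

theorem detectRight_of_serreMap {X W N : C} {t : (X ⟶ W) →ₗ[k] k}
    (h : Function.Bijective (serreMap t N)) : DetectRight N X W := by
  intro v hv
  by_contra! H
  refine hv ((Module.forall_dual_apply_eq_zero_iff k v).1 fun φ => ?_)
  obtain ⟨u, rfl⟩ := h.2 φ
  simp [H u]

theorem finrank_of_serreMap {X W N : C} {t : (X ⟶ W) →ₗ[k] k}
    (h : Function.Bijective (serreMap t N)) :
    Module.finrank k (N ⟶ W) = Module.finrank k (X ⟶ N) :=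
  (LinearEquiv.ofBijective _ h).finrank_eq.trans Subspace.dual_finrank_eq

theorem DetectLeft.compNeZero {X N W : C} (h : DetectLeft N X W) (h' : HomLine k X N) :
    CompNeZero X N W := by
  intro p q hp hq hpq
  obtain ⟨v, hv⟩ := h q hq
  obtain ⟨c, rfl⟩ := h' v p hp
  rw [Linear.smul_comp, hpq, smul_zero] at hv
  exact hv rfl

theorem finrank_eq_zero_of_homZero {A B : C} (h : HomZero A B) : Module.finrank k (A ⟶ B) = 0 := by
  have : Subsingleton (A ⟶ B) := ⟨fun f g => (h f).trans (h g).symm⟩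
  exact Module.finrank_zero_of_subsingleton

theorem finiteDimensional_of_finrank_eq_one {A B : C} (h : Module.finrank k (A ⟶ B) = 1) :
    FiniteDimensional k (A ⟶ B) :=
  Module.finite_of_finrank_eq_succ h

theorem finiteDimensional_of_homZero {A B : C} (h : HomZero A B) :
    FiniteDimensional k (A ⟶ B) := by
  have : Subsingleton (A ⟶ B) := ⟨fun f g => (h f).trans (h g).symm⟩
  infer_instance

theorem exists_functional {A B : C} (h : Module.finrank k (A ⟶ B) = 1) :
    ∃ t : (A ⟶ B) →ₗ[k] k, ∀ x, t x = 0 → x = 0 := by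
  have := finiteDimensional_of_finrank_eq_one h
  let e : (A ⟶ B) ≃ₗ[k] k := LinearEquiv.ofFinrankEq _ _ (by simp [h])
  exact ⟨e, fun x hx => by simpa using hx⟩

end Compact

section Sphere

variable {k : Type u} [Field k]
variable {C : Type u} [Category.{v} C] [Preadditive C] [HasZeroObject C] [HasShift C ℤ]
  [∀ n : ℤ, (shiftFunctor C n).Additive] [Pretriangulated C]
  [Linear k C] [HasFiniteBiproducts C] [∀ n : ℤ, Functor.Linear k (shiftFunctor C n)]

/-- The graded endomorphism space of `R` is that of a sphere of dimension `D + 1 ≥ 2`. -/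
structure IsSphereLike (k : Type u) [Field k] [Linear k C] (R : C) (D : ℤ) : Prop where
  one_le : 1 ≤ D
  homZero : ∀ i : ℤ, i ≠ 0 → i ≠ -(D + 1) → HomZero (R⟦i⟧) R
  finrank_end : Module.finrank k (R ⟶ R) = 1
  finrank_top : Module.finrank k (R ⟶ R⟦D + 1⟧) = 1

theorem Cardinal.eq_one_of_sum_eq_two {f : ℤ → Cardinal.{v}} (h : Cardinal.sum f = 2) {a b : ℤ}
    (hab : a ≠ b) (ha : f a = 1) (hb : f b ≠ 0) :
    f b = 1 ∧ ∀ i, i ≠ a → i ≠ b → f i = 0 := by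
  have key : ∀ g : ℤ → Cardinal.{v}, (∀ i, g i ≤ f i) → Cardinal.sum g ≤ 2 := fun g hg =>
    (Cardinal.sum_le_sum _ _ hg).trans h.le
  have hb' : 1 ≤ f b := Cardinal.one_le_iff_ne_zero.2 hb
  constructor
  · have := key (fun i => (if i = a then f a else 0) + (if i = b then f b else 0)) (by
      intro i
      by_cases h1 : i = a
      · subst h1; simp [hab]
      · by_cases h2 : i = b
        · subst h2; simp [h1]
        · simp [h1, h2])
    rw [Cardinal.sum_add_distrib'] at this
    have h1 := Cardinal.le_sum (fun i => if i = a then f a else 0) a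
    have h2 := Cardinal.le_sum (fun i => if i = b then f b else 0) b
    simp only [if_true] at h1 h2
    have h3 := (add_le_add h1 h2).trans this
    rw [ha] at h3
    have hfin : f b < Cardinal.aleph0 :=
      lt_of_le_of_lt ((self_le_add_left _ _).trans h3) (Cardinal.ofNat_lt_aleph0)
    obtain ⟨n, hn⟩ := Cardinal.lt_aleph0.1 hfin
    rw [hn] at h3 hb' ⊢
    norm_cast at h3 hb' ⊢
    omega
  · intro c hca hcb
    by_contra hc
    have hc' : 1 ≤ f c := Cardinal.one_le_iff_ne_zero.2 hc
    have := key (fun i => (if i = a then 1 else 0) + ((if i = b then 1 else 0) +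
      (if i = c then 1 else 0))) (by
      intro i
      by_cases h1 : i = a
      · subst h1; simp [hab, hca.symm, ha]
      · by_cases h2 : i = b
        · subst h2; simpa [h1, hcb.symm] using hb'
        · by_cases h3 : i = c
          · subst h3; simpa [h1, h2] using hc'
          · simp [h1, h2, h3])
    rw [Cardinal.sum_add_distrib', Cardinal.sum_add_distrib'] at this
    have h1 := Cardinal.le_sum (fun i => if i = a then (1 : Cardinal.{v}) else 0) a
    have h2 := Cardinal.le_sum (fun i => if i = b then (1 : Cardinal.{v}) else 0) b
    have h3 := Cardinal.le_sum (fun i => if i = c then (1 : Cardinal.{v}) else 0) c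
    simp only [if_true] at h1 h2 h3
    have h4 := (add_le_add h1 (add_le_add h2 h3)).trans this
    norm_cast at h4

theorem Cardinal.sum_le_one {f : ℤ → Cardinal.{v}} {a : ℤ} (ha : f a ≤ 1)
    (h : ∀ i, i ≠ a → f i = 0) : Cardinal.sum f ≤ 1 := by
  have : ∀ i, f i ≤ Cardinal.mk (ULift.{v} (PLift (i = a))) := by
    intro i
    by_cases hi : i = a
    · subst hi; simpa using ha
    · simp [h i hi]
  refine (Cardinal.sum_le_sum _ _ this).trans ?_
  rw [← Cardinal.mk_sigma]
  exact Cardinal.le_one_iff_subsingleton.2 ⟨by rintro ⟨i, ⟨⟨rfl⟩⟩⟩ ⟨j, ⟨⟨rfl⟩⟩⟩; rfl⟩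

variable {Co : Type u} [Category.{v} Co] [Preadditive Co] [HasZeroObject Co] [HasShift Co ℤ]
  [∀ n : ℤ, (shiftFunctor Co n).Additive] [Pretriangulated Co]
  [Linear k Co] [HasFiniteBiproducts Co] [∀ n : ℤ, Functor.Linear k (shiftFunctor Co n)]

theorem DGSetup.isSphereLike (S : DGSetup k C Co) (h2 : S.dimH = 2) :
    IsSphereLike k S.R (S.d - 1) := by
  have hpos : ∀ i : ℤ, Subsingleton (S.H S.R i) → Module.rank k (S.H S.R i) = 0 := fun i hi =>
    rank_subsingleton' k _
  have hne : ∀ i : ℤ, Module.rank k (S.H S.R i) = 0 → Subsingleton (S.H S.R i) := fun i hi =>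
    rank_zero_iff.1 hi
  have h0 : Module.rank k (S.H S.R 0) = 1 := by
    obtain ⟨e⟩ := S.HR_zero
    have := e.lift_rank_eq
    rw [Module.rank_self k, Cardinal.lift_one, Cardinal.lift_eq_one] at this
    exact this
  have hdn : Module.rank k (S.H S.R S.d) ≠ 0 := fun h =>
    not_subsingleton_iff_nontrivial.2 S.d_mem (hne _ h)
  have hd0 : 0 ≤ S.d := by
    by_contra! h
    exact not_subsingleton_iff_nontrivial.2 S.d_mem (S.HR_neg _ h)
  have hd1 : S.d ≠ 1 := by
    intro h
    refine not_subsingleton_iff_nontrivial.2 S.d_mem ?_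
    rw [h]; exact S.HR_one
  have hd0' : S.d ≠ 0 := by
    intro h
    have : S.dimH ≤ 1 := Cardinal.sum_le_one (a := 0) h0.le fun i hi => by
      apply hpos
      rcases lt_or_gt_of_ne hi with hi | hi
      · exact S.HR_neg i hi
      · by_contra hn
        have := S.d_greatest i (not_subsingleton_iff_nontrivial.1 hn)
        omega
    rw [h2] at this
    norm_cast at this
  obtain ⟨htop, hz⟩ := Cardinal.eq_one_of_sum_eq_two h2 hd0'.symm h0 hdn
  refine ⟨by omega, ?_, ?_, ?_⟩
  · intro i hi hi'
    have : HomZero S.R (S.R⟦-i⟧) := by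
      have := hne _ (hz (-i) (by omega) (by omega))
      exact fun f => Subsingleton.elim _ _
    exact this.shift i (Iso.refl _) (shiftShiftNegIso _ (by omega))
  · rw [← (Linear.homCongr k (Iso.refl S.R) (shiftZeroIso S.R)).finrank_eq]
    exact Module.rank_eq_one_iff_finrank_eq_one.1 h0
  · rw [show S.d - 1 + 1 = S.d by omega]
    exact Module.rank_eq_one_iff_finrank_eq_one.1 htop

theorem exists_ne_zero_of_finrank {A B : C} (h : Module.finrank k (A ⟶ B) = 1) :
    ∃ f : A ⟶ B, f ≠ 0 := by
  have : Nontrivial (A ⟶ B) := Module.nontrivial_of_finrank_pos (R := k) (by omega)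
  exact exists_ne 0

/-- The isomorphism `M⟦i⟧⟦j⟧ ≅ M⟦j⟧⟦i⟧`. -/
noncomputable def shiftSwapIso (M : C) (i j : ℤ) : (M⟦i⟧)⟦j⟧ ≅ (M⟦j⟧)⟦i⟧ :=
  shiftShiftIso M rfl ≪≫ (shiftShiftIso M (add_comm j i)).symm

namespace IsSphereLike

variable {R : C} {D : ℤ} (hR : IsSphereLike k R D)

include hR

theorem homZero_shift {i j : ℤ} (h : i ≠ j) (h' : i ≠ j - (D + 1)) : HomZero (R⟦i⟧) (R⟦j⟧) :=
  (hR.homZero (i - j) (by omega) (by omega)).shift_right (by omega)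

theorem homZero_right {j : ℤ} (h : j ≠ 0) (h' : j ≠ D + 1) : HomZero R (R⟦j⟧) :=
  (hR.homZero_shift (i := 0) h.symm (by omega)).congr (shiftZeroIso R) (Iso.refl _)

theorem finrank_zero : Module.finrank k (R ⟶ R⟦(0 : ℤ)⟧) = 1 := by
  rw [(Linear.homCongr k (Iso.refl R) (shiftZeroIso R)).finrank_eq, hR.finrank_end]

theorem finiteDimensional (j : ℤ) : FiniteDimensional k (R ⟶ R⟦j⟧) := by
  by_cases h : j = 0
  · subst h
    exact finiteDimensional_of_finrank_eq_one hR.finrank_zero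
  by_cases h' : j = D + 1
  · subst h'
    exact finiteDimensional_of_finrank_eq_one hR.finrank_top
  exact finiteDimensional_of_homZero (hR.homZero_right h h')

theorem id_ne_zero : 𝟙 R ≠ 0 := by
  obtain ⟨f, hf⟩ := exists_ne_zero_of_finrank hR.finrank_end
  intro h
  rw [← Category.id_comp f, h, zero_comp] at hf
  exact hf rfl

theorem detectLeft_base (j : ℤ) : DetectLeft (R⟦j⟧) R (R⟦D + 1⟧) := by
  intro u hu
  by_cases h : j = 0
  · subst h
    refine ⟨(shiftZeroIso R).inv, fun h => hu ?_⟩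
    rw [← Category.id_comp u, ← (shiftZeroIso R).hom_inv_id, Category.assoc, h, comp_zero]
  by_cases h' : j = D + 1
  · subst h'
    obtain ⟨g, hg⟩ := exists_ne_zero_of_finrank hR.finrank_top
    have hline : HomLine k (R⟦D + 1⟧) (R⟦D + 1⟧) :=
      (HomLine.of_finrank hR.finrank_end).shift _ (Iso.refl _) (Iso.refl _)
    refine ⟨g, fun h => hg ?_⟩
    obtain ⟨c, hc⟩ := hline (𝟙 _) u hu
    rw [← Category.comp_id g, hc, Linear.comp_smul, h, smul_zero]
  · exact absurd (hR.homZero_shift h' (by omega) u) hu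

theorem finrank_base (j : ℤ) :
    Module.finrank k (R⟦j⟧ ⟶ R⟦D + 1⟧) = Module.finrank k (R ⟶ R⟦j⟧) := by
  by_cases h : j = 0
  · subst h
    rw [hR.finrank_zero, ← hR.finrank_top]
    exact (Linear.homCongr k (shiftZeroIso R) (Iso.refl _)).finrank_eq
  by_cases h' : j = D + 1
  · subst h'
    rw [hR.finrank_top, ← (shiftHomEquiv k R R (D + 1)).finrank_eq, hR.finrank_end]
  · rw [finrank_eq_zero_of_homZero (hR.homZero_right h h'),
      finrank_eq_zero_of_homZero (hR.homZero_shift h' (by omega))]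

theorem exists_serreMap : ∃ t : (R ⟶ R⟦D + 1⟧) →ₗ[k] k,
    ∀ M : C, FinitelyBuilt C R M → Function.Bijective (serreMap t M) := by
  obtain ⟨t, ht⟩ := exists_functional hR.finrank_top
  refine ⟨t, fun M hM => serreMap_bijective t (fun j => ?_) hM⟩
  have := hR.finiteDimensional j
  have : FiniteDimensional k (R⟦j⟧ ⟶ R⟦D + 1⟧) := by
    have := hR.finiteDimensional (D + 1 - j)
    exact Module.Finite.equiv ((shiftHomEquiv k R (R⟦D + 1 - j⟧) j).trans
      (Linear.homCongr k (Iso.refl _) (shiftShiftIso R (by omega))))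
  exact serreMap_bijective_of_detectLeft ht (hR.detectLeft_base j) (hR.finrank_base j)

variable {M : C} (hM : FinitelyBuilt C R M)

include hM

theorem finrank_eq : Module.finrank k (M ⟶ R⟦D + 1⟧) = Module.finrank k (R ⟶ M) := by
  obtain ⟨t, ht⟩ := hR.exists_serreMap
  exact finrank_of_serreMap (ht M hM)

theorem detectLeft {i j : ℤ} (h : i + (D + 1) = j) : DetectLeft M (R⟦i⟧) (R⟦j⟧) := by
  obtain ⟨t, ht⟩ := hR.exists_serreMap
  exact (detectLeft_of_serreMap (ht _ (hM.shift (-i)))).shift i (shiftShiftNegIso _ (by omega))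
    (Iso.refl _) (shiftShiftIso _ (by omega))

theorem homZero_of_homZero {i j : ℤ} (h : i + (D + 1) = j) (H : HomZero (R⟦i⟧) M) :
    HomZero M (R⟦j⟧) := by
  intro u
  by_contra hu
  obtain ⟨v, hv⟩ := hR.detectLeft hM h u hu
  rw [H v, zero_comp] at hv
  exact hv rfl

end IsSphereLike

/-- Invariants of the objects in the component of the Auslander-Reiten quiver containing `R`;
the cohomology of `X` is concentrated in degrees `0` and `e`. -/
structure IsSphereLike.Good (k : Type u) [Field k] [Linear k C] (R : C) (D e : ℤ) (X : C) :
    Prop where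
  mem : FinitelyBuilt C R X
  finrank_hom : Module.finrank k (R ⟶ X) = 1
  homZero : ∀ i : ℤ, i ≠ 0 → i ≠ -e → HomZero (R⟦i⟧) X
  top : ¬ HomZero (R⟦-e⟧) X
  homZero_self : HomZero X (X⟦D⟧)
  homLine_self : HomLine k X (X⟦D + 1⟧)
  compNeZero : CompNeZero (X⟦-D⟧) (R⟦(1 : ℤ)⟧) (X⟦(1 : ℤ)⟧)
  detectLeft : ∀ j : ℤ, DetectLeft (R⟦j⟧) X (X⟦D + 1⟧)

namespace IsSphereLike

variable {R : C} {D : ℤ} (hR : IsSphereLike k R D)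

include hR

theorem good_base : Good k R D (D + 1) R where
  mem := FinitelyBuilt.base
  finrank_hom := hR.finrank_end
  homZero := hR.homZero
  top := by
    obtain ⟨g, hg⟩ := exists_ne_zero_of_finrank hR.finrank_top
    exact fun h => hg (h.shift (D + 1) (shiftShiftNegIso _ (by omega)) (Iso.refl _) g)
  homZero_self := hR.homZero_right (by have := hR.one_le; omega) (by omega)
  homLine_self := HomLine.of_finrank hR.finrank_top
  compNeZero := by
    intro p q hp hq h
    obtain ⟨c, hc⟩ := ((HomLine.of_finrank hR.finrank_end).shift 1 (Iso.refl _) (Iso.refl _) :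
      HomLine k (R⟦(1 : ℤ)⟧) (R⟦(1 : ℤ)⟧)) (𝟙 _) q hq
    apply hp
    rw [← Category.comp_id p, hc, Linear.comp_smul, h, smul_zero]
  detectLeft := hR.detectLeft_base

variable {e : ℤ} {X : C}

theorem Good.homLine_top (G : Good k R D e X) : HomLine k (X⟦-D⟧) (R⟦(1 : ℤ)⟧) :=
  (HomLine.of_finrank ((hR.finrank_eq G.mem).trans G.finrank_hom)).shift (-D) (Iso.refl _)
    (shiftShiftIso _ (by omega))

theorem Good.compNeZero_top (G : Good k R D e X) :
    CompNeZero (R⟦-D⟧) (X⟦-D⟧) (R⟦(1 : ℤ)⟧) :=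
  ((hR.detectLeft G.mem (i := 0) (zero_add _)).compNeZero
    ((HomLine.of_finrank G.finrank_hom).shift 0 (Iso.refl _) (shiftZeroIso _))).shift (-D)
    (shiftShiftIso _ (by omega)) (Iso.refl _) (shiftShiftIso _ (by omega))

end IsSphereLike

section Step

variable {R : C} {D : ℤ} (hR : IsSphereLike k R D) {e : ℤ} {X X' : C}
  (G : IsSphereLike.Good k R D e X) (he : D + 1 ≤ e) {a : R ⟶ X'} {r : X' ⟶ X⟦-D⟧}
  {p : X⟦-D⟧ ⟶ R⟦(1 : ℤ)⟧} (T : Triangle.mk a r p ∈ distTriang C) (hp : p ≠ 0)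

namespace IsSphereLike.Good

include G

theorem homZero_tau {i : ℤ} (h : i ≠ -D) (h' : i ≠ -(e + D)) : HomZero (R⟦i⟧) (X⟦-D⟧) :=
  (G.homZero (i + D) (by omega) (by omega)).shift_right (by omega)

include hR he T

theorem map_ne_zero : a ≠ 0 := by
  rintro rfl
  have hD := hR.one_le
  obtain ⟨w, hw⟩ := exact_one T (𝟙 _) (by simp)
  rw [G.homZero_tau (by omega) (by omega) w, zero_comp] at hw
  apply shift_map_ne_zero hR.id_ne_zero 1
  rw [← hw]; simp

theorem homLine_next : HomLine k R X' := by
  intro f g hg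
  have hD := hR.one_le
  have hz : HomZero R (X⟦-D⟧) :=
    (G.homZero_tau (i := 0) (by omega) (by omega)).congr (shiftZeroIso R) (Iso.refl _)
  obtain ⟨f', rfl⟩ := exact_two T f (hz _)
  obtain ⟨g', rfl⟩ := exact_two T g (hz _)
  obtain ⟨c, rfl⟩ := HomLine.of_finrank (k := k) hR.finrank_end f' g' (by rintro rfl; simp at hg)
  exact ⟨c, by simp⟩

include hp

theorem homZero_next {i : ℤ} (hi : i ≠ 0) (hi' : i ≠ -(e + D)) : HomZero (R⟦i⟧) X' := by
  intro f
  have hD := hR.one_le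
  have hf : f ≫ r = 0 := by
    by_cases h : i = -D
    · subst h
      by_contra h
      exact G.compNeZero_top hR _ _ h hp (by rw [Category.assoc, comp_zero₂₃ T, comp_zero])
    · exact G.homZero_tau h hi' _
  obtain ⟨g, rfl⟩ := exact_two T f hf
  by_cases h : i = -(D + 1)
  · subst h
    have hl : HomLine k ((R⟦-(D + 1)⟧)⟦(1 : ℤ)⟧) (R⟦(1 : ℤ)⟧) :=
      (HomLine.of_finrank hR.finrank_top).shift (-D) (shiftShiftIso _ (by omega)).symm
        (shiftShiftIso _ (by omega))
    obtain ⟨w, hw⟩ := exists_ne_zero_of_finrank G.finrank_hom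
    let ι : (R⟦-(D + 1)⟧)⟦(1 : ℤ)⟧ ≅ R⟦-D⟧ := shiftShiftIso _ (by omega)
    have h1 := G.compNeZero_top hR _ _ (shift_map_ne_zero hw (-D)) hp
    obtain ⟨c, hc⟩ := hl (g⟦(1 : ℤ)⟧') (ι.hom ≫ w⟦-D⟧' ≫ p) (by
      intro h0
      apply h1
      rw [← cancel_epi ι.hom, h0, comp_zero])
    apply (shiftFunctor C (1 : ℤ)).map_injective
    simp only [Functor.map_comp, hc, Functor.map_zero, Linear.smul_comp, Category.assoc,
      comp_zero₃₁ T, comp_zero, smul_zero]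
  · rw [hR.homZero i hi h g, zero_comp]

theorem homZero_next_prev : HomZero X' X := by
  intro v
  have hav : a ≫ v = 0 := by
    by_contra h
    apply G.compNeZero p ((a ≫ v)⟦(1 : ℤ)⟧') hp (shift_map_ne_zero h 1)
    rw [Functor.map_comp, ← Category.assoc, comp_zero₃₁ T, zero_comp]
  obtain ⟨w, rfl⟩ := coexact_two T v hav
  have : HomZero (X⟦-D⟧) X := G.homZero_self.shift (-D) (Iso.refl _) (shiftShiftNegIso _ (by omega))
  rw [this w, comp_zero]

theorem top_next : ¬ HomZero (R⟦-(e + D)⟧) X' := by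
  intro H
  have hD := hR.one_le
  apply G.top
  refine HomZero.unshift_right (i' := -(e + D)) (j' := -D) ?_ (by omega)
  intro w
  obtain ⟨f, rfl⟩ := exact_three T w (hR.homZero_shift (by omega) (by omega) _)
  rw [H f, zero_comp]

theorem homZero_self_next : HomZero X' (X'⟦D⟧) := by
  intro f
  have hD := hR.one_le
  have h1 : HomZero R (X'⟦D⟧) :=
    (G.homZero_next hR he T hp (i := -D) (by omega) (by omega)).shift D
      (shiftShiftNegIso _ (by omega)) (Iso.refl _)
  obtain ⟨w, rfl⟩ := coexact_two T f (h1 _)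
  have h2 : HomZero (X⟦-D⟧) ((X⟦-D⟧)⟦D⟧) :=
    G.homZero_self.shift (-D) (Iso.refl _) (shiftSwapIso _ _ _)
  obtain ⟨z, rfl⟩ := exact_two_shift T D w (h2 _)
  by_cases h : D = 1
  · subst h
    obtain ⟨c, rfl⟩ := G.homLine_top hR z p hp
    rw [Linear.smul_comp, comp_zero₃₁ T, smul_zero, comp_zero]
  · have h3 : HomZero (X⟦-D⟧) (R⟦D⟧) :=
      hR.homZero_of_homZero (G.mem.shift _) (i := -1) (by omega)
        (G.homZero_tau (by omega) (by omega))
    rw [h3 z, zero_comp, comp_zero]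

theorem homLine_self_next : HomLine k X' (X'⟦D + 1⟧) := by
  intro f g hg
  have hD := hR.one_le
  have h1 : HomZero R (X'⟦D + 1⟧) :=
    (G.homZero_next hR he T hp (i := -(D + 1)) (by omega) (by omega)).shift (D + 1)
      (shiftShiftNegIso _ (by omega)) (Iso.refl _)
  obtain ⟨w, rfl⟩ := coexact_two T f (h1 _)
  obtain ⟨w', rfl⟩ := coexact_two T g (h1 _)
  have h2 : HomZero (X⟦-D⟧) (R⟦D + 1⟧) :=
    hR.homZero_of_homZero (G.mem.shift _) (i := 0) (by omega)
      (G.homZero_tau (by omega) (by omega))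
  have h3 : ∀ z : X⟦-D⟧ ⟶ X'⟦D + 1⟧, z ≫ r⟦D + 1⟧' = 0 → z = 0 := by
    intro z hz
    obtain ⟨y, rfl⟩ := exact_two_shift T _ z hz
    rw [h2 y, zero_comp]
  have h4 : HomLine k (X⟦-D⟧) ((X⟦-D⟧)⟦D + 1⟧) :=
    G.homLine_self.shift (-D) (Iso.refl _) (shiftSwapIso _ _ _)
  obtain ⟨c, hc⟩ := h4 (w ≫ r⟦D + 1⟧') (w' ≫ r⟦D + 1⟧') (by
    intro h
    rw [h3 _ h, comp_zero] at hg
    exact hg rfl)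
  have : w - c • w' = 0 := h3 _ (by rw [Preadditive.sub_comp, hc, Linear.smul_comp, sub_self])
  exact ⟨c, by rw [sub_eq_zero.1 this, Linear.comp_smul]⟩

theorem compNeZero_next : CompNeZero (X'⟦-D⟧) (R⟦(1 : ℤ)⟧) (X'⟦(1 : ℤ)⟧) := by
  intro q u hq hu h
  obtain ⟨c, hc⟩ := ((G.homLine_next hR he T).shift 1 (Iso.refl _) (Iso.refl _) :
    HomLine k (R⟦(1 : ℤ)⟧) (X'⟦(1 : ℤ)⟧)) (a⟦(1 : ℤ)⟧') u hu
  obtain ⟨z, rfl⟩ := exact_one T q (by rw [hc, Linear.comp_smul, h, smul_zero])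
  rw [(G.homZero_next_prev hR he T hp).shift (-D) (Iso.refl _) (Iso.refl _) z, zero_comp] at hq
  exact hq rfl

theorem next : Good k R D (e + D) X' where
  mem := FinitelyBuilt.extension T FinitelyBuilt.base (G.mem.shift _)
  finrank_hom := (G.homLine_next hR he T).finrank (G.map_ne_zero hR he T)
  homZero _ := G.homZero_next hR he T hp
  top := G.top_next hR he T hp
  homZero_self := G.homZero_self_next hR he T hp
  homLine_self := G.homLine_self_next hR he T hp
  compNeZero := G.compNeZero_next hR he T hp
  detectLeft j u hu := by
    have hD := hR.one_le
    by_cases h : u ≫ r⟦D + 1⟧' = 0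
    · obtain ⟨w, rfl⟩ := exact_two_shift T _ u h
      obtain rfl : j = D + 1 := by
        by_contra hj
        by_cases hj' : j = 0
        · have : HomZero (R⟦j⟧) (X'⟦D + 1⟧) :=
            (G.homZero_next hR he T hp (i := -(D + 1)) (by omega) (by omega)).shift_right
              (by omega)
          exact hu (this _)
        · rw [hR.homZero_shift hj (by omega) w, zero_comp] at hu
          exact hu rfl
      have hn : Module.finrank k (X' ⟶ R⟦D + 1⟧) = 1 :=
        (hR.finrank_eq (FinitelyBuilt.extension T FinitelyBuilt.base (G.mem.shift _))).trans
          ((G.homLine_next hR he T).finrank (G.map_ne_zero hR he T))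
      obtain ⟨q, hq⟩ := exists_ne_zero_of_finrank hn
      exact ⟨q, ((G.compNeZero_next hR he T hp).shift D (shiftShiftNegIso _ (by omega))
        (shiftShiftIso _ (by omega)) (shiftShiftIso _ (by omega)) :
          CompNeZero X' (R⟦D + 1⟧) (X'⟦D + 1⟧)) q _ hq hu⟩
    · have hd : DetectLeft (R⟦j⟧) (X⟦-D⟧) ((X⟦-D⟧)⟦D + 1⟧) :=
        (G.detectLeft (j + D)).shift (-D) (shiftShiftIso _ (by omega)) (Iso.refl _)
          (shiftSwapIso _ _ _)
      obtain ⟨v, hv⟩ := hd _ h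
      refine ⟨r ≫ v, fun h0 => hv ?_⟩
      obtain ⟨s, hs⟩ := coexact_three T (v ≫ u) (by rw [← Category.assoc, h0])
      have hz : HomZero (R⟦(1 : ℤ)⟧) (X'⟦D + 1⟧) :=
        (G.homZero_next hR he T hp (i := -D) (by omega) (by omega)).shift_right (by omega)
      rw [← Category.assoc, hs, hz s, comp_zero, zero_comp]

end IsSphereLike.Good

end Step

end Sphere

section Bricks

variable {k : Type u} [Field k]
variable {C : Type u} [Category.{v} C] [Preadditive C] [HasZeroObject C] [HasShift C ℤ]
  [∀ n : ℤ, (shiftFunctor C n).Additive] [Pretriangulated C]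
  [Linear k C] [HasFiniteBiproducts C] [∀ n : ℤ, Functor.Linear k (shiftFunctor C n)]

/-- An object `Z` finitely built from `R` whose endomorphism ring is a division ring and such
that `Hom(-, Z⟦D + 1⟧)` is in perfect duality with `Hom(Z, -)`. -/
structure IsSerreBrick (R : C) (D : ℤ) (Z : C) : Prop where
  mem : FinitelyBuilt C R Z
  id_ne_zero : 𝟙 Z ≠ 0
  isIso : ∀ f : Z ⟶ Z, f ≠ 0 → IsIso f
  detectLeft : ∀ N : C, FinitelyBuilt C R N → DetectLeft N Z (Z⟦D + 1⟧)
  detectRight : ∀ N : C, FinitelyBuilt C R N → DetectRight N Z (Z⟦D + 1⟧)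

namespace IsSphereLike.Good

variable {R : C} {D e : ℤ} {X : C} (hR : IsSphereLike k R D) (G : Good k R D e X)

include hR G

theorem finrank_self : Module.finrank k (X ⟶ X⟦D + 1⟧) = 1 := by
  obtain ⟨q, hq⟩ := exists_ne_zero_of_finrank ((hR.finrank_eq G.mem).trans G.finrank_hom)
  obtain ⟨g, hg⟩ := exists_ne_zero_of_finrank G.finrank_hom
  exact G.homLine_self.finrank ((G.compNeZero.shift D (shiftShiftNegIso _ (by omega))
    (shiftShiftIso _ (by omega)) (shiftShiftIso _ (by omega)) :
      CompNeZero X (R⟦D + 1⟧) (X⟦D + 1⟧)) q _ hq (shift_map_ne_zero hg (D + 1)))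

theorem exists_serreMap : ∃ t : (X ⟶ X⟦D + 1⟧) →ₗ[k] k,
    ∀ M : C, FinitelyBuilt C R M → Function.Bijective (serreMap t M) := by
  obtain ⟨t, ht⟩ := exists_functional (G.finrank_self hR)
  refine ⟨t, fun M hM => serreMap_bijective t (fun j => ?_) hM⟩
  let E₁ : (X⟦D + 1 - j⟧ ⟶ R⟦D + 1⟧) ≃ₗ[k] (X ⟶ R⟦j⟧) :=
    ((shiftHomEquiv k X (R⟦j⟧) (D + 1 - j)).trans
      (Linear.homCongr k (Iso.refl _) (shiftShiftIso R (by omega)))).symm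
  let E₂ : (R ⟶ X⟦D + 1 - j⟧) ≃ₗ[k] (R⟦j⟧ ⟶ X⟦D + 1⟧) :=
    (shiftHomEquiv k R (X⟦D + 1 - j⟧) j).trans
      (Linear.homCongr k (Iso.refl _) (shiftShiftIso X (by omega)))
  have h₂ : FiniteDimensional k (R ⟶ X⟦D + 1 - j⟧) :=
    (G.mem.shift _).finiteDimensional_hom hR.finiteDimensional
  have h₁ : FiniteDimensional k (X⟦D + 1 - j⟧ ⟶ R⟦D + 1⟧) := by
    obtain ⟨s, hs⟩ := hR.exists_serreMap
    exact Module.Finite.equiv (LinearEquiv.ofBijective _ (hs _ (G.mem.shift (D + 1 - j)))).symm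
  have := Module.Finite.equiv E₁
  have := Module.Finite.equiv E₂
  refine serreMap_bijective_of_detectLeft ht (G.detectLeft j) ?_
  rw [← E₁.finrank_eq, ← E₂.finrank_eq, hR.finrank_eq (G.mem.shift _)]

theorem isSerreBrick : IsSerreBrick R D X := by
  obtain ⟨t, ht⟩ := G.exists_serreMap hR
  have hend : Module.finrank k (X ⟶ X) = 1 :=
    (finrank_of_serreMap (ht X G.mem)).symm.trans (G.finrank_self hR)
  have hid : 𝟙 X ≠ 0 := by
    obtain ⟨g, hg⟩ := exists_ne_zero_of_finrank G.finrank_hom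
    intro h
    rw [← Category.comp_id g, h, comp_zero] at hg
    exact hg rfl
  refine ⟨G.mem, hid, fun f hf => ?_, fun N hN => detectLeft_of_serreMap (ht N hN),
    fun N hN => detectRight_of_serreMap (ht N hN)⟩
  obtain ⟨c, hc⟩ := HomLine.of_finrank hend (𝟙 X) f hf
  exact ⟨c • 𝟙 X, by simp [hc.symm], by simp [hc.symm]⟩

end IsSphereLike.Good

namespace IsSerreBrick

variable {R : C} {D : ℤ} {Z : C}

theorem congr (hZ : IsSerreBrick R D Z) {Z' : C} (e : Z ≅ Z') : IsSerreBrick R D Z' where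
  mem := hZ.mem.iso e
  id_ne_zero h := hZ.id_ne_zero (by
    rw [← e.hom_inv_id, ← Category.id_comp e.inv, h, zero_comp, comp_zero])
  isIso f hf := by
    have : IsIso (e.hom ≫ f ≫ e.inv) := hZ.isIso _ fun h => hf (by
      rw [← cancel_epi e.hom, ← cancel_mono e.inv, Category.assoc, h]; simp)
    have h : f = e.inv ≫ (e.hom ≫ f ≫ e.inv) ≫ e.hom := by simp
    rw [h]
    infer_instance
  detectLeft N hN := (hZ.detectLeft N hN).shift 0 (shiftZeroIso _) (shiftZeroIso _ ≪≫ e)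
    (shiftZeroIso _ ≪≫ (shiftFunctor C (D + 1)).mapIso e)
  detectRight N hN := (hZ.detectRight N hN).shift 0 (shiftZeroIso _) (shiftZeroIso _ ≪≫ e)
    (shiftZeroIso _ ≪≫ (shiftFunctor C (D + 1)).mapIso e)

theorem shift (hZ : IsSerreBrick R D Z) (n : ℤ) : IsSerreBrick R D (Z⟦n⟧) where
  mem := hZ.mem.shift n
  id_ne_zero h := shift_map_ne_zero hZ.id_ne_zero n (by
    rw [CategoryTheory.Functor.map_id, h])
  isIso f hf := by
    obtain ⟨g, rfl⟩ := (shiftFunctor C n).map_surjective f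
    have := hZ.isIso g (by rintro rfl; simp at hf)
    infer_instance
  detectLeft N hN := (hZ.detectLeft _ (hN.shift (-n))).shift n (shiftShiftNegIso _ (by omega))
    (Iso.refl _) (shiftSwapIso _ _ _)
  detectRight N hN := (hZ.detectRight _ (hN.shift (-n))).shift n (shiftShiftNegIso _ (by omega))
    (Iso.refl _) (shiftSwapIso _ _ _)

theorem isIso_of_comp_eq_id (hZ : IsSerreBrick R D Z) {X : C} {w : X ⟶ Z} {r : Z ⟶ X}
    (h : w ≫ r = 𝟙 X) (hX : 𝟙 X ≠ 0) : IsIso w := by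
  have h1 : r ≫ w ≠ 0 := by
    intro h0
    apply hX
    rw [← Category.comp_id (𝟙 X), ← h, Category.assoc, ← Category.assoc r, h0, zero_comp, comp_zero]
  have := hZ.isIso _ h1
  have : IsSplitMono w := ⟨⟨r, h⟩⟩
  have : IsSplitEpi w := ⟨⟨inv (r ≫ w) ≫ r, by simp⟩⟩
  exact isIso_of_mono_of_isSplitEpi w

theorem isIso_of_comp_ne_zero {A B : C} (hA : IsSerreBrick R D A) (hB : IsSerreBrick R D B)
    {f : A ⟶ B} {g : B ⟶ A} (h : f ≫ g ≠ 0) : IsIso f := by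
  have := hA.isIso _ h
  exact hB.isIso_of_comp_eq_id (r := g ≫ inv (f ≫ g)) (by rw [← Category.assoc]; simp)
    hA.id_ne_zero

/-- The objects finitely built from `R`, as a class of objects. -/
def _root_.builtFrom (R : C) : Set C := {M | FinitelyBuilt C R M}

theorem isARTriangle (hZ : IsSerreBrick R D Z) {X Y : C} (e : X ≅ Z⟦D⟧) {f : X ⟶ Y} {g : Y ⟶ Z}
    {h : Z ⟶ X⟦(1 : ℤ)⟧} (T : Triangle.mk f g h ∈ distTriang C) (hh : h ≠ 0) :
    IsARTriangle C (builtFrom R) f g h := by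
  have hX : IsSerreBrick R D X := (hZ.shift D).congr e.symm
  let ψ : X⟦(1 : ℤ)⟧ ≅ Z⟦D + 1⟧ := (shiftFunctor C (1 : ℤ)).mapIso e ≪≫ shiftShiftIso _ rfl
  refine ⟨hX.mem, FinitelyBuilt.extension T hX.mem hZ.mem, hZ.mem, T, hh, ?_, ?_⟩
  · intro N' hN' u hu
    by_cases h0 : h ≫ u⟦(1 : ℤ)⟧' = 0
    · obtain ⟨w, hw⟩ := coexact_one T u h0
      exact ⟨w, hw.symm⟩
    · exfalso
      obtain ⟨w, hw⟩ := hZ.detectRight _ (FinitelyBuilt.shift 1 hN') _ h0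
      obtain ⟨w', hw'⟩ := (shiftFunctor C (1 : ℤ)).map_surjective (w ≫ ψ.inv)
      have h1 : u ≫ w' ≠ 0 := by
        intro h1
        apply hw
        rw [← cancel_mono ψ.inv, Category.assoc, Category.assoc, ← hw', ← Functor.map_comp, h1]
        simp
      have := hX.isIso _ h1
      exact hu ⟨w' ≫ inv (u ≫ w'), by rw [← Category.assoc]; simp⟩
  · intro N' hN' v hv
    by_cases h0 : v ≫ h = 0
    · obtain ⟨w, hw⟩ := exact_three T v h0
      exact ⟨w, hw.symm⟩
    · exfalso
      obtain ⟨w, hw⟩ := hZ.detectLeft _ hN' (v ≫ h ≫ ψ.hom) (by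
        intro h1
        apply h0
        rw [← cancel_mono ψ.hom, Category.assoc, h1, zero_comp])
      have h1 : w ≫ v ≠ 0 := by
        intro h1
        apply hw
        rw [reassoc_of% h1, zero_comp]
      have := hZ.isIso _ h1
      exact hv ⟨inv (w ≫ v) ≫ w, by simp⟩

theorem exists_isARTriangle (hZ : IsSerreBrick R D Z) {X : C} (e : X ≅ Z⟦D⟧) :
    ∃ (Y : C) (f : X ⟶ Y) (g : Y ⟶ Z) (h : Z ⟶ X⟦(1 : ℤ)⟧),
      IsARTriangle C (builtFrom R) f g h := by
  let ψ : X⟦(1 : ℤ)⟧ ≅ Z⟦D + 1⟧ := (shiftFunctor C (1 : ℤ)).mapIso e ≪≫ shiftShiftIso _ rfl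
  obtain ⟨w, hw⟩ := hZ.detectRight _ hZ.mem _ hZ.id_ne_zero
  rw [Category.id_comp] at hw
  obtain ⟨Y, f, g, T⟩ := distinguished_cocone_triangle₂ (w ≫ ψ.inv)
  exact ⟨Y, f, g, _, hZ.isARTriangle e T fun h => hw (by
    rw [← cancel_mono ψ.inv, h, zero_comp])⟩

theorem nonempty_iso_of_isARTriangle (hZ : IsSerreBrick R D Z) {X Y : C} {f : X ⟶ Y}
    {g : Y ⟶ Z} {h : Z ⟶ X⟦(1 : ℤ)⟧} (T : IsARTriangle C (builtFrom R) f g h) :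
    Nonempty (X ≅ Z⟦D⟧) := by
  let ψ : (Z⟦D⟧)⟦(1 : ℤ)⟧ ≅ Z⟦D + 1⟧ := shiftShiftIso _ rfl
  obtain ⟨w, hw⟩ := hZ.detectRight _ (FinitelyBuilt.shift 1 T.memX) h T.h_ne
  obtain ⟨w', hw'⟩ := (shiftFunctor C (1 : ℤ)).map_surjective (w ≫ ψ.inv)
  have h1 : h ≫ w'⟦(1 : ℤ)⟧' ≠ 0 := by
    intro h1
    apply hw
    rw [← cancel_mono ψ.inv, Category.assoc, ← hw', h1, zero_comp]
  have h2 : ∃ r : Z⟦D⟧ ⟶ X, w' ≫ r = 𝟙 X := by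
    by_contra h2
    obtain ⟨v, rfl⟩ := T.fac_left _ (hZ.mem.shift D) w' h2
    apply h1
    rw [Functor.map_comp, ← Category.assoc, comp_zero₃₁ T.dist, zero_comp]
  obtain ⟨r, hr⟩ := h2
  have hX : 𝟙 X ≠ 0 := by
    intro hX
    apply h1
    rw [← Category.id_comp w', hX, zero_comp, Functor.map_zero, comp_zero]
  have := (hZ.shift D).isIso_of_comp_eq_id hr hX
  exact ⟨asIso w'⟩

end IsSerreBrick

end Bricks

section Killing

variable {k : Type u} [Field k]
variable {C : Type u} [Category.{v} C] [Preadditive C] [HasZeroObject C] [HasShift C ℤ]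
  [∀ n : ℤ, (shiftFunctor C n).Additive] [Pretriangulated C]
  [Linear k C] [HasFiniteBiproducts C] [∀ n : ℤ, Functor.Linear k (shiftFunctor C n)]

namespace IsSphereLike

variable {R : C} {D : ℤ} (hR : IsSphereLike k R D)

include hR

/-- Attaching a cell to kill a class in the lowest nonvanishing degree of the cohomology of `L`
lowers the dimension in that degree. -/
theorem exists_cell_attachment {L : C} (hfin : ∀ i : ℤ, FiniteDimensional k (R⟦i⟧ ⟶ L)) {m : ℤ}
    (hL : ∀ i : ℤ, i > m → HomZero (R⟦i⟧) L) (hm : ¬ HomZero (R⟦m⟧) L) :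
    ∃ (L' : C) (φ : L ⟶ L'), (∀ i : ℤ, FiniteDimensional k (R⟦i⟧ ⟶ L')) ∧
      (∀ i : ℤ, i > m → HomZero (R⟦i⟧) L') ∧
      Module.finrank k (R⟦m⟧ ⟶ L') < Module.finrank k (R⟦m⟧ ⟶ L) ∧
      ∀ Y : C, HomZero Y (R⟦m⟧) → ∀ u : Y ⟶ L, u ≫ φ = 0 → u = 0 := by
  have hD := hR.one_le
  obtain ⟨f, hf⟩ : ∃ f : R⟦m⟧ ⟶ L, f ≠ 0 := by simpa [HomZero] using hm
  obtain ⟨L', φ, h, T⟩ := distinguished_cocone_triangle f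
  have hfin' : ∀ i : ℤ, FiniteDimensional k (R⟦i⟧ ⟶ L') := fun i => by
    have := hfin i
    have : FiniteDimensional k (R⟦i⟧ ⟶ (R⟦m⟧)⟦(1 : ℤ)⟧) := by
      have := hR.finiteDimensional (m + 1 - i)
      exact Module.Finite.equiv ((shiftHomEquiv k R (R⟦m + 1 - i⟧) i).trans
        (Linear.homCongr k (Iso.refl _)
          (shiftShiftIso R (by omega) ≪≫ (shiftShiftIso R rfl).symm)))
    exact finiteDimensional_hom_cone T _
  refine ⟨L', φ, hfin', fun i hi u => ?_, ?_, fun Y hY u hu => ?_⟩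
  · have hu : u ≫ h = 0 := by
      by_cases h' : i = m + 1
      · subst h'
        have hl : HomLine k (R⟦m + 1⟧) ((R⟦m⟧)⟦(1 : ℤ)⟧) :=
          (HomLine.of_finrank hR.finrank_end).shift (m + 1) (Iso.refl _) (shiftShiftIso R rfl).symm
        by_contra h0
        obtain ⟨c, hc⟩ := hl (shiftShiftIso R rfl).inv (u ≫ h) h0
        apply shift_map_ne_zero hf 1
        rw [← cancel_epi (shiftShiftIso R (i := m) (j := 1) rfl).inv, hc, Linear.smul_comp,
          Category.assoc, comp_zero₃₁ T]
        simp
      · exact (hR.homZero_shift h' (by omega)).congr (Iso.refl _) (shiftShiftIso R rfl).symm _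
    obtain ⟨w, rfl⟩ := exact_three T u hu
    rw [hL i hi w, zero_comp]
  · have hs : Function.Surjective (Linear.rightComp k (R⟦m⟧) φ) := fun u => by
      obtain ⟨w, rfl⟩ := exact_three T u ((hR.homZero_shift (i := m) (j := m + 1) (by omega)
        (by omega)).congr (Iso.refl _) (shiftShiftIso R rfl).symm _)
      exact ⟨w, rfl⟩
    have := hfin m
    have hk : 0 < Module.finrank k (LinearMap.ker (Linear.rightComp k (R⟦m⟧) φ)) := by
      rw [Module.finrank_pos_iff]
      exact ⟨⟨f, by simpa using comp_zero₁₂ T⟩, 0, fun h => hf (by simpa using h)⟩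
    have hn := (Linear.rightComp k (R⟦m⟧) φ).finrank_range_add_finrank_ker
    rw [LinearMap.range_eq_top.2 hs, _root_.finrank_top] at hn
    omega
  · obtain ⟨w, rfl⟩ := exact_two T u hu
    rw [hY w, zero_comp]

theorem exists_kill_degree {L : C} (hfin : ∀ i : ℤ, FiniteDimensional k (R⟦i⟧ ⟶ L)) {m : ℤ}
    (hL : ∀ i : ℤ, i > m → HomZero (R⟦i⟧) L) :
    ∃ (L' : C) (φ : L ⟶ L'), (∀ i : ℤ, FiniteDimensional k (R⟦i⟧ ⟶ L')) ∧
      (∀ i : ℤ, i ≥ m → HomZero (R⟦i⟧) L') ∧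
      ∀ Y : C, HomZero Y (R⟦m⟧) → ∀ u : Y ⟶ L, u ≫ φ = 0 → u = 0 := by
  induction hn : Module.finrank k (R⟦m⟧ ⟶ L) using Nat.strong_induction_on generalizing L with
  | _ n ih =>
    by_cases hm : HomZero (R⟦m⟧) L
    · refine ⟨L, 𝟙 L, hfin, fun i hi => ?_, fun Y _ u hu => by simpa using hu⟩
      obtain rfl | h := eq_or_lt_of_le hi
      exacts [hm, hL i h]
    · obtain ⟨L₁, φ, h1, h2, h3, h4⟩ := hR.exists_cell_attachment hfin hL hm
      obtain ⟨L', ψ, h5, h6, h7⟩ := ih _ (hn ▸ h3) h1 h2 rfl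
      exact ⟨L', φ ≫ ψ, h5, h6, fun Y hY u hu => h4 Y hY u (h7 Y hY _ (by simpa using hu))⟩

theorem exists_kill_degrees {L : C} (hfin : ∀ i : ℤ, FiniteDimensional k (R⟦i⟧ ⟶ L)) {s : ℤ}
    (hL : ∀ i : ℤ, i ≥ s → HomZero (R⟦i⟧) L) (n : ℕ) :
    ∃ (L' : C) (φ : L ⟶ L'), (∀ i : ℤ, FiniteDimensional k (R⟦i⟧ ⟶ L')) ∧
      (∀ i : ℤ, i ≥ s - n → HomZero (R⟦i⟧) L') ∧
      ∀ Y : C, (∀ j : ℤ, s - n ≤ j → j < s → HomZero Y (R⟦j⟧)) →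
        ∀ u : Y ⟶ L, u ≫ φ = 0 → u = 0 := by
  induction n with
  | zero => exact ⟨L, 𝟙 L, hfin, by simpa using hL, fun Y _ u hu => by simpa using hu⟩
  | succ n ih =>
    obtain ⟨L₁, φ, h1, h2, h3⟩ := ih
    obtain ⟨L', ψ, h4, h5, h6⟩ := hR.exists_kill_degree h1 (m := s - n - 1)
      fun i hi => h2 i (by omega)
    push_cast
    exact ⟨L', φ ≫ ψ, h4, fun i hi => h5 i (by omega), fun Y hY u hu =>
      h3 Y (fun j hj hj' => hY j (by omega) hj') u
        (h6 Y (hY _ (by omega) (by omega)) _ (by simpa using hu))⟩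

end IsSphereLike

end Killing

section Sequence

variable {k : Type u} [Field k]
variable {C : Type u} [Category.{v} C] [Preadditive C] [HasZeroObject C] [HasShift C ℤ]
  [∀ n : ℤ, (shiftFunctor C n).Additive] [Pretriangulated C]
  [Linear k C] [HasFiniteBiproducts C] [∀ n : ℤ, Functor.Linear k (shiftFunctor C n)]

/-- The ray of the Auslander-Reiten quiver starting at `R`: each object is the
extension of a shift of its predecessor by `R` given by a nonzero morphism `p n`. -/
structure SphereRay (k : Type u) [Field k] [Linear k C] (R : C) (D : ℤ) where
  X : ℕ → C
  a : ∀ n, R ⟶ X n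
  r : ∀ n, X (n + 1) ⟶ (X n)⟦-D⟧
  p : ∀ n, (X n)⟦-D⟧ ⟶ R⟦(1 : ℤ)⟧
  isIso_a_zero : IsIso (a 0)
  dist : ∀ n, Triangle.mk (a (n + 1)) (r n) (p n) ∈ distTriang C
  p_ne_zero : ∀ n, p n ≠ 0
  good : ∀ n : ℕ, IsSphereLike.Good k R D (D + 1 + n * D) (X n)

namespace IsSphereLike

variable {R : C} {D : ℤ} (hR : IsSphereLike k R D)

include hR

theorem Good.exists_next {e : ℤ} (he : D + 1 ≤ e) {X : C} (G : Good k R D e X) :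
    ∃ (X' : C) (a : R ⟶ X') (r : X' ⟶ X⟦-D⟧) (p : X⟦-D⟧ ⟶ R⟦(1 : ℤ)⟧),
      Triangle.mk a r p ∈ distTriang C ∧ p ≠ 0 ∧ Good k R D (e + D) X' := by
  obtain ⟨q, hq⟩ := exists_ne_zero_of_finrank ((hR.finrank_eq G.mem).trans G.finrank_hom)
  let ι : (R⟦D + 1⟧)⟦-D⟧ ≅ R⟦(1 : ℤ)⟧ := shiftShiftIso _ (by omega)
  have hp : q⟦-D⟧' ≫ ι.hom ≠ 0 := fun h => shift_map_ne_zero hq (-D) (by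
    rw [← cancel_mono ι.hom, h, zero_comp])
  obtain ⟨X', a, r, T⟩ := distinguished_cocone_triangle₂ (q⟦-D⟧' ≫ ι.hom)
  exact ⟨X', a, r, _, T, hp, G.next hR he T hp⟩

theorem nonempty_sphereRay : Nonempty (SphereRay k R D) := by
  have hD := hR.one_le
  let Stage := {s : ℤ × C // D + 1 ≤ s.1 ∧ Good k R D s.1 s.2}
  have hs : ∀ s : Stage, ∃ (X' : C) (a : R ⟶ X') (r : X' ⟶ s.1.2⟦-D⟧)
      (p : s.1.2⟦-D⟧ ⟶ R⟦(1 : ℤ)⟧), Triangle.mk a r p ∈ distTriang C ∧ p ≠ 0 ∧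
        Good k R D (s.1.1 + D) X' := fun s => s.2.2.exists_next hR s.2.1
  choose X' a r p T hp hG using hs
  let F : ℕ → Stage := fun n => Nat.rec ⟨(D + 1, R), le_rfl, hR.good_base⟩
    (fun _ s => ⟨(s.1.1 + D, X' s), by have := s.2.1; dsimp only; omega, hG s⟩) n
  have hF : ∀ n : ℕ, (F n).1.1 = D + 1 + n * D := fun n => by
    induction n with
    | zero => simp [F]
    | succ n ih =>
      change (F n).1.1 + D = _
      rw [ih]
      push_cast
      ring
  exact ⟨{
    X := fun n => (F n).1.2
    a := fun n => match n with
      | 0 => 𝟙 R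
      | n + 1 => a (F n)
    r := fun n => r (F n)
    p := fun n => p (F n)
    isIso_a_zero := inferInstanceAs (IsIso (𝟙 R))
    dist := fun n => T (F n)
    p_ne_zero := fun n => hp (F n)
    good := fun n => hF n ▸ (F n).2.2 }⟩

end IsSphereLike

namespace SphereRay

variable {R : C} {D : ℤ} (hR : IsSphereLike k R D) (S : SphereRay k R D)

include hR

theorem le_add_mul (n : ℕ) : D + 1 ≤ D + 1 + n * D := by
  have := hR.one_le
  nlinarith [Int.natCast_nonneg n]

theorem brick (n : ℕ) (i : ℤ) : IsSerreBrick R D ((S.X n)⟦i⟧) :=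
  ((S.good n).isSerreBrick hR).shift i

theorem brick_zero (n : ℕ) : IsSerreBrick R D (S.X n) := (S.good n).isSerreBrick hR

theorem a_ne_zero (n : ℕ) : S.a n ≠ 0 := by
  cases n with
  | zero =>
    intro h
    have := S.isIso_a_zero
    exact hR.id_ne_zero ((cancel_mono (S.a 0)).1 (by simp [h]))
  | succ n => exact (S.good n).map_ne_zero hR (le_add_mul hR n) (S.dist n)

theorem exists_map_comp_eq {n : ℕ} {N : C} (hN : FinitelyBuilt C R N) (f : S.X n ⟶ N)
    (hf : ¬ ∃ r : N ⟶ S.X n, f ≫ r = 𝟙 _) : ∃ u, S.a n ≫ f = S.a (n + 1) ≫ u := by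
  apply coexact_one (S.dist n)
  by_contra h
  let ι : ((S.X n)⟦-D⟧)⟦D + 1⟧ ≅ (S.X n)⟦(1 : ℤ)⟧ := shiftShiftIso _ (by omega)
  obtain ⟨w, hw⟩ := (S.brick hR n (-D)).detectRight _ (hN.shift 1) _ h
  obtain ⟨w', hw'⟩ := (shiftFunctor C (1 : ℤ)).map_surjective (w ≫ ι.hom)
  have h1 : f ≫ w' ≠ 0 := by
    intro h1
    apply hw
    rw [← cancel_mono ι.hom, Category.assoc, ← hw', Category.assoc, ← Functor.map_comp,
      Category.assoc, h1]
    simp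
  have := (S.brick_zero hR n).isIso _ h1
  exact hf ⟨w' ≫ inv (f ≫ w'), by rw [← Category.assoc]; simp⟩

theorem homZero_base {n : ℕ} {j : ℤ} (h : j ≠ D + 1) (h' : j ≠ -(n * D)) :
    HomZero (S.X n) (R⟦j⟧) :=
  hR.homZero_of_homZero (S.good n).mem (i := j - (D + 1)) (by omega)
    ((S.good n).homZero _ (by omega) (by omega))

theorem exists_splitMono_of_lowest {M : C} (hM : FinitelyBuilt C R M)
    (hlow : ∀ i : ℤ, i ≥ 1 → HomZero (R⟦i⟧) M) {f : R ⟶ M} (hf : f ≠ 0) :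
    ∃ (n : ℕ) (w : S.X n ⟶ M) (s : M ⟶ S.X n), w ≫ s = 𝟙 _ := by
  by_contra! H
  have hD := hR.one_le
  have hfac : ∀ n, ∃ g, f = S.a n ≫ g := fun n => by
    induction n with
    | zero =>
      have := S.isIso_a_zero
      exact ⟨inv (S.a 0) ≫ f, by simp⟩
    | succ n ih =>
      obtain ⟨g, rfl⟩ := ih
      exact S.exists_map_comp_eq hR hM g fun ⟨s, hs⟩ => H n g s hs
  obtain ⟨q, hq⟩ := hM.compact
  have hfin : ∀ i : ℤ, FiniteDimensional k (R⟦i⟧ ⟶ M) := fun i => by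
    have : FiniteDimensional k (R ⟶ M⟦-i⟧) :=
      (hM.shift _).finiteDimensional_hom hR.finiteDimensional
    exact Module.Finite.equiv ((shiftHomEquiv k R (M⟦-i⟧) i).trans
      (Linear.homCongr k (Iso.refl _) (shiftShiftNegIso M (by omega))))
  obtain ⟨L, φ, -, h1, h2⟩ := hR.exists_kill_degrees hfin hlow (1 - q).toNat
  have hφ : φ = 0 := hq L (fun i hi => h1 i (by omega)) φ
  obtain ⟨g, rfl⟩ := hfac ((1 - q).toNat + 1)
  refine hf ?_
  rw [h2 _ (fun j hj hj' => S.homZero_base hR (by omega) ?_) g (by rw [hφ, comp_zero]), comp_zero]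
  have : ((1 - q).toNat : ℤ) + 1 ≤ (((1 - q).toNat + 1 : ℕ) : ℤ) * D := by
    push_cast
    nlinarith [Int.natCast_nonneg (1 - q).toNat]
  omega

theorem exists_splitMono {M : C} (hM : FinitelyBuilt C R M) (h0 : ¬ IsZero M) :
    ∃ (n : ℕ) (i : ℤ) (w : (S.X n)⟦i⟧ ⟶ M) (s : M ⟶ (S.X n)⟦i⟧), w ≫ s = 𝟙 _ := by
  have hD := hR.one_le
  obtain ⟨b, hb⟩ := hM.bounded ⟨1, fun i hi => hR.homZero i (by omega) (by omega)⟩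
  obtain ⟨i, hi, hmax⟩ := Int.exists_greatest_of_bdd (P := fun i => ¬ HomZero (R⟦i⟧) M)
    ⟨b, fun i hi => by
      by_contra h
      exact hi (hb i (by omega))⟩ (by
      by_contra! H
      obtain ⟨q, hq⟩ := hM.compact
      exact h0 ((IsZero.iff_id_eq_zero M).2 (hq M (fun i _ => H i) _)))
  obtain ⟨f, hf⟩ : ∃ f : R⟦i⟧ ⟶ M, f ≠ 0 := by simpa [HomZero] using hi
  let ι : (R⟦i⟧)⟦-i⟧ ≅ R := shiftShiftNegIso _ (by omega)
  obtain ⟨n, w, s, h⟩ := S.exists_splitMono_of_lowest hR (hM.shift (-i)) (fun j hj =>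
    HomZero.shift_right (i := j + i) (by
      by_contra h
      have := hmax _ h
      omega) (by omega)) (f := ι.inv ≫ f⟦-i⟧') (fun h => shift_map_ne_zero hf (-i) (by
      rw [← cancel_epi ι.inv, h, comp_zero]))
  let κ : (M⟦-i⟧)⟦i⟧ ≅ M := shiftShiftNegIso _ (by omega)
  exact ⟨n, i, w⟦i⟧' ≫ κ.hom, κ.inv ≫ s⟦i⟧', by simp [← Functor.map_comp, h]⟩

end SphereRay

end Sequence

section Indecomposables

variable {k : Type u} [Field k]
variable {C : Type u} [Category.{v} C] [Preadditive C] [HasZeroObject C] [HasShift C ℤ]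
  [∀ n : ℤ, (shiftFunctor C n).Additive] [Pretriangulated C]
  [Linear k C] [HasFiniteBiproducts C] [∀ n : ℤ, Functor.Linear k (shiftFunctor C n)]

theorem Indec.isIso_of_comp_eq_id {Z M : C} (hM : Indec C M) (hZ : ¬ IsZero Z) {w : Z ⟶ M}
    {s : M ⟶ Z} (h : w ≫ s = 𝟙 Z) : IsIso w := by
  obtain ⟨B, g, d, T⟩ := distinguished_cocone_triangle w
  have hd : d = 0 := by
    have h1 : w⟦(1 : ℤ)⟧' ≫ s⟦(1 : ℤ)⟧' = 𝟙 _ := by rw [← Functor.map_comp, h]; simp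
    rw [← Category.comp_id d, ← h1, ← Category.assoc, comp_zero₃₁ T, zero_comp]
  obtain ⟨e, -⟩ := exists_iso_binaryBiproduct_of_distTriang _ T hd
  exact (Triangle.isZero₃_iff_isIso₁ _ T).1 ((hM.2 Z B ⟨e⟩).resolve_left hZ)

theorem isIso_of_isLocalRing_end {Z M : C} [IsLocalRing (End M)] (hZ : 𝟙 Z ≠ 0) {w : Z ⟶ M}
    {s : M ⟶ Z} (h : w ≫ s = 𝟙 Z) : IsIso w := by
  let e : End M := s ≫ w
  have he : e * (1 - e) = 0 := by
    change (𝟙 M - s ≫ w) ≫ s ≫ w = 0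
    rw [Preadditive.sub_comp, Category.assoc, reassoc_of% h, Category.id_comp, sub_self]
  obtain hu | hu := IsLocalRing.isUnit_or_isUnit_of_add_one (add_sub_cancel e 1)
  · have h1 : 1 - e = 0 := hu.mul_right_eq_zero.1 he
    exact ⟨s, h, (sub_eq_zero.1 h1).symm⟩
  · have h1 : s ≫ w = 0 := hu.mul_left_eq_zero.1 he
    exact absurd (by rw [← Category.id_comp (𝟙 Z), ← h, Category.assoc, reassoc_of% h1, zero_comp,
      comp_zero]) hZ

theorem IsSerreBrick.not_isZero {R : C} {D : ℤ} {Z : C} (hZ : IsSerreBrick R D Z) : ¬ IsZero Z :=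
  fun h => hZ.id_ne_zero (h.eq_of_src _ _)

theorem IsSerreBrick.indec {R : C} {D : ℤ} {Z : C} (hZ : IsSerreBrick R D Z) : Indec C Z := by
  refine ⟨hZ.not_isZero, fun A B ⟨e⟩ => ?_⟩
  by_cases h : e.hom ≫ biprod.fst ≫ biprod.inl ≫ e.inv = 0
  · left
    rw [IsZero.iff_id_eq_zero]
    have h1 : biprod.inl ≫ e.inv ≫ (e.hom ≫ biprod.fst ≫ biprod.inl ≫ e.inv) ≫ e.hom ≫
      biprod.fst = 𝟙 A := by simp
    rw [← h1, h]
    simp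
  · right
    have := hZ.isIso _ h
    have h2 : e.hom ≫ biprod.snd ≫ biprod.inr ≫ e.inv = 0 := by
      rw [← cancel_epi (e.hom ≫ biprod.fst ≫ biprod.inl ≫ e.inv)]
      simp
    rw [IsZero.iff_id_eq_zero]
    have h1 : biprod.inr ≫ e.inv ≫ (e.hom ≫ biprod.snd ≫ biprod.inr ≫ e.inv) ≫ e.hom ≫
      biprod.snd = 𝟙 B := by simp
    rw [← h1, h2]
    simp

theorem IrredMor.shift {R : C} {M N : C} {f : M ⟶ N} (hf : IrredMor C (builtFrom R) f) (n : ℤ) :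
    IrredMor C (builtFrom R) (f⟦n⟧') := by
  refine ⟨fun h => hf.1 ((isIso_iff_of_reflects_iso f (shiftFunctor C n)).1 h),
    fun L hL σ ρ h => ?_⟩
  let κ : (L⟦-n⟧)⟦n⟧ ≅ L := shiftShiftNegIso _ (by omega)
  obtain ⟨σ', hσ⟩ := (shiftFunctor C n).map_surjective (σ ≫ κ.inv)
  obtain ⟨ρ', hρ⟩ := (shiftFunctor C n).map_surjective (κ.hom ≫ ρ)
  obtain ⟨s, hs⟩ | ⟨s, hs⟩ := hf.2 _ (FinitelyBuilt.shift (-n) hL) σ' ρ'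
    ((shiftFunctor C n).map_injective (by simp [hσ, hρ, h]))
  · left
    refine ⟨s⟦n⟧' ≫ κ.hom, ?_⟩
    rw [Category.assoc, ← hρ, ← Functor.map_comp, hs, CategoryTheory.Functor.map_id]
  · right
    refine ⟨κ.inv ≫ s⟦n⟧', ?_⟩
    rw [← Category.assoc, ← hσ, ← Functor.map_comp, hs, CategoryTheory.Functor.map_id]

theorem IrredMor.iso_comp {P : Set C} {M M' N : C} {f : M ⟶ N} (hf : IrredMor C P f)
    (e : M' ≅ M) : IrredMor C P (e.hom ≫ f) := by
  refine ⟨fun h => hf.1 (IsIso.of_isIso_comp_left e.hom f), fun L hL σ ρ h => ?_⟩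
  obtain h1 | ⟨s, hs⟩ := hf.2 L hL (e.inv ≫ σ) ρ (by simp [h])
  · exact Or.inl h1
  · exact Or.inr ⟨s ≫ e.inv, by
      rw [← cancel_epi e.inv, ← Category.assoc σ, ← Category.assoc e.inv, ← Category.assoc e.inv,
        hs]
      simp⟩

end Indecomposables

section Arrows

variable {k : Type u} [Field k]
variable {C : Type u} [Category.{v} C] [Preadditive C] [HasZeroObject C] [HasShift C ℤ]
  [∀ n : ℤ, (shiftFunctor C n).Additive] [Pretriangulated C]
  [Linear k C] [HasFiniteBiproducts C] [∀ n : ℤ, Functor.Linear k (shiftFunctor C n)]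

namespace SphereRay

variable {R : C} {D : ℤ} (hR : IsSphereLike k R D) (S : SphereRay k R D)

include hR S

theorem nonempty_iso_of_indec {M : C} (hM : FinitelyBuilt C R M) (h : Indec C M) :
    ∃ (n : ℕ) (i : ℤ), Nonempty ((S.X n)⟦i⟧ ≅ M) := by
  obtain ⟨n, i, w, s, hw⟩ := S.exists_splitMono hR hM h.1
  have := h.isIso_of_comp_eq_id (S.brick hR n i).not_isZero hw
  exact ⟨n, i, ⟨asIso w⟩⟩

theorem isSerreBrick_of_indec {M : C} (hM : FinitelyBuilt C R M) (h : Indec C M) :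
    IsSerreBrick R D M := by
  obtain ⟨n, i, ⟨e⟩⟩ := S.nonempty_iso_of_indec hR hM h
  exact (S.brick hR n i).congr e

theorem isSerreBrick_of_isLocalRing {M : C} (hM : FinitelyBuilt C R M) [IsLocalRing (End M)] :
    IsSerreBrick R D M := by
  have h0 : ¬ IsZero M := fun h => one_ne_zero (α := End M) (h.eq_of_src _ _)
  obtain ⟨n, i, w, s, hw⟩ := S.exists_splitMono hR hM h0
  have := isIso_of_isLocalRing_end (S.brick hR n i).id_ne_zero hw
  exact (S.brick hR n i).congr (asIso w)

theorem hasARTriangles : HasARTriangles C (builtFrom R) := by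
  refine ⟨fun Z hZ _ => ?_, fun X hX _ => ?_⟩
  · obtain ⟨Y, f, g, h, T⟩ :=
      (S.isSerreBrick_of_isLocalRing hR hZ).exists_isARTriangle (Iso.refl (Z⟦D⟧))
    exact ⟨_, Y, f, g, h, T⟩
  · obtain ⟨Y, f, g, h, T⟩ := ((S.isSerreBrick_of_isLocalRing hR hX).shift (-D)).exists_isARTriangle
      (shiftShiftNegIso X (by omega)).symm
    exact ⟨Y, _, f, g, h, T⟩

theorem not_homZero_iff {n : ℕ} {i l : ℤ} :
    ¬ HomZero (R⟦l⟧) ((S.X n)⟦i⟧) ↔ l = i ∨ l = i - (D + 1 + n * D) := by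
  constructor
  · intro h
    by_contra! h'
    exact h (((S.good n).homZero (l - i) (by omega) (by omega)).shift_right (by omega))
  · rintro (rfl | rfl) h
    · exact S.a_ne_zero hR n (h.shift (-l) (shiftShiftNegIso _ (by omega))
        (shiftShiftNegIso _ (by omega)) _)
    · exact (S.good n).top (h.unshift_right (by omega))

theorem eq_of_iso {n m : ℕ} {i j : ℤ} (e : (S.X n)⟦i⟧ ≅ (S.X m)⟦j⟧) : i = j ∧ n = m := by
  have hD := hR.one_le
  have hn := le_add_mul hR n
  have hm := le_add_mul hR m
  have h1 : ∀ l, (l = i ∨ l = i - (D + 1 + n * D)) ↔ (l = j ∨ l = j - (D + 1 + m * D)) := fun l => by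
    rw [← S.not_homZero_iff hR, ← S.not_homZero_iff hR, not_iff_not]
    exact ⟨fun h => h.congr (Iso.refl _) e, fun h => h.congr (Iso.refl _) e.symm⟩
  have h2 := (h1 i).1 (Or.inl rfl)
  have h3 := (h1 j).2 (Or.inl rfl)
  have h4 := (h1 (i - (D + 1 + n * D))).1 (Or.inr rfl)
  have h5 : i = j := by omega
  refine ⟨h5, ?_⟩
  have h6 : (n : ℤ) * D = m * D := by omega
  exact_mod_cast mul_right_cancel₀ (by omega : D ≠ 0) h6

theorem exists_link (n : ℕ) : ∃ i : S.X n ⟶ S.X (n + 1), S.a n ≫ i = S.a (n + 1) := by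
  induction n with
  | zero =>
    have := S.isIso_a_zero
    exact ⟨inv (S.a 0) ≫ S.a 1, by simp⟩
  | succ n ih =>
    obtain ⟨i, hi⟩ := ih
    obtain ⟨j, hj⟩ := coexact_one (S.dist n) (S.a (n + 2)) (by
      obtain ⟨c, hc⟩ := (S.good n).homLine_top hR (S.p n) (i⟦-D⟧' ≫ S.p (n + 1)) (by
        intro h
        apply (S.good (n + 1)).compNeZero_top hR _ _
          (shift_map_ne_zero (S.a_ne_zero hR (n + 1)) (-D)) (S.p_ne_zero (n + 1))
        rw [← hi, Functor.map_comp, Category.assoc, h, comp_zero])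
      rw [hc, Linear.smul_comp, Category.assoc, comp_zero₃₁ (S.dist (n + 1)), comp_zero, smul_zero])
    exact ⟨j, hj.symm⟩

theorem not_isIso_r (n : ℕ) : ¬ IsIso (S.r n) := fun _ => by
  have := (S.eq_of_iso hR (shiftZeroIso _ ≪≫ asIso (S.r n))).2
  omega

variable {n : ℕ} {i : S.X n ⟶ S.X (n + 1)}

theorem not_isIso_link : ¬ IsIso i := fun _ => by
  have := (S.eq_of_iso hR (shiftZeroIso _ ≪≫ asIso i ≪≫ (shiftZeroIso _).symm)).2
  omega

theorem irredMor_link (hi : S.a n ≫ i = S.a (n + 1)) : IrredMor C (builtFrom R) i := by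
  refine ⟨S.not_isIso_link hR, fun L hL σ ρ h => or_iff_not_imp_right.2 fun hσ => ?_⟩
  obtain ⟨u, hu⟩ := S.exists_map_comp_eq hR hL σ hσ
  have h1 : u ≫ ρ ≠ 0 := fun h1 => S.a_ne_zero hR (n + 1) (by
    rw [← hi, ← h, reassoc_of% hu, h1, comp_zero])
  have := (S.brick_zero hR (n + 1)).isIso _ h1
  exact ⟨inv (u ≫ ρ) ≫ u, by simp⟩

theorem exists_fac_zero {i : S.X 0 ⟶ S.X 1} (hi : S.a 0 ≫ i = S.a 1) {N : C}
    (hN : FinitelyBuilt C R N) (f : S.X 0 ⟶ N) (hf : ¬ ∃ r : N ⟶ S.X 0, f ≫ r = 𝟙 _) :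
    ∃ u, i ≫ u = f := by
  obtain ⟨u, hu⟩ := S.exists_map_comp_eq hR hN f hf
  have := S.isIso_a_zero
  exact ⟨u, by rw [← cancel_epi (S.a 0), hu, reassoc_of% hi]⟩

theorem exists_fac_succ {i : S.X (n + 1) ⟶ S.X (n + 2)} (hi : S.a (n + 1) ≫ i = S.a (n + 2))
    {N : C} (hN : FinitelyBuilt C R N) (f : S.X (n + 1) ⟶ N)
    (hf : ¬ ∃ r : N ⟶ S.X (n + 1), f ≫ r = 𝟙 _) : ∃ u w, i ≫ u + S.r n ≫ w = f := by
  obtain ⟨u, hu⟩ := S.exists_map_comp_eq hR hN f hf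
  obtain ⟨w, hw⟩ := coexact_two (S.dist n) (f - i ≫ u) (by
    rw [Preadditive.comp_sub, hu, reassoc_of% hi, sub_self])
  exact ⟨u, w, by rw [← hw]; abel⟩

theorem irredMor_r (n : ℕ) : IrredMor C (builtFrom R) (S.r n) := by
  have hD := hR.one_le
  refine ⟨S.not_isIso_r hR n, fun L hL σ ρ h => or_iff_not_imp_right.2 fun hσ => ?_⟩
  obtain ⟨i, hi⟩ := S.exists_link hR (n + 1)
  obtain ⟨u, w, rfl⟩ := S.exists_fac_succ hR hi hL σ hσ
  have h1 : w ≫ ρ ≠ 0 := fun h1 => by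
    have hn := le_add_mul hR n
    have h2 : ¬ HomZero (R⟦-(D + 1 + n * D) - D⟧) ((S.X n)⟦-D⟧) :=
      (S.not_homZero_iff hR).2 (Or.inr (by ring))
    apply h2
    intro b
    obtain ⟨b', rfl⟩ := exact_three (S.dist n) b (hR.homZero_shift (by omega) (by omega) _)
    have h3 : b' ≫ i = 0 := (S.good (n + 2)).homZero _ (by omega) (by
      push_cast
      nlinarith) _
    rw [← h, Preadditive.add_comp, Category.assoc, Category.assoc, h1, comp_zero, add_zero,
      reassoc_of% h3, zero_comp]
  have := (S.brick hR n (-D)).isIso _ h1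
  exact ⟨inv (w ≫ ρ) ≫ w, by simp⟩

theorem iso_of_irredMor {n : ℕ} {N : C} (hN : IsSerreBrick R D N) {f : S.X n ⟶ N}
    (hf : IrredMor C (builtFrom R) f) :
    Nonempty (N ≅ S.X (n + 1)) ∨ ∃ m, n = m + 1 ∧ Nonempty (N ≅ (S.X m)⟦-D⟧) := by
  have hs : ¬ ∃ r : N ⟶ S.X n, f ≫ r = 𝟙 _ := fun ⟨r, hr⟩ =>
    hf.1 (hN.isIso_of_comp_eq_id hr (S.brick_zero hR n).id_ne_zero)
  obtain ⟨i, hi⟩ := S.exists_link hR n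
  cases n with
  | zero =>
    obtain ⟨u, hu⟩ := S.exists_fac_zero hR hi hN.mem f hs
    obtain ⟨s, h⟩ | ⟨s, h⟩ := hf.2 _ (S.good 1).mem i u hu
    · have := (S.brick_zero hR 1).isIso_of_comp_eq_id h hN.id_ne_zero
      exact Or.inl ⟨asIso s⟩
    · exact absurd ((S.brick_zero hR 1).isIso_of_comp_eq_id h (S.brick_zero hR 0).id_ne_zero)
        (S.not_isIso_link hR)
  | succ n =>
    obtain ⟨u, w, hu⟩ := S.exists_fac_succ hR hi hN.mem f hs
    obtain ⟨s, h⟩ | ⟨s, h⟩ := hf.2 (S.X (n + 2) ⊞ (S.X n)⟦-D⟧)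
      ((S.good (n + 2)).mem.biprod ((S.good n).mem.shift _)) (biprod.lift i (S.r n))
      (biprod.desc u w) (by simpa using hu)
    · have h1 : (s ≫ biprod.fst) ≫ u + (s ≫ biprod.snd) ≫ w = 𝟙 N := by
        rw [← h, biprod.desc_eq, Preadditive.comp_add, Category.assoc, Category.assoc]
      by_cases h2 : (s ≫ biprod.fst) ≫ u = 0
      · have h3 : (s ≫ biprod.snd) ≫ w ≠ 0 := fun h3 => hN.id_ne_zero (by
          rw [← h1, h2, h3, add_zero])
        have := hN.isIso_of_comp_ne_zero (S.brick hR n (-D)) h3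
        exact Or.inr ⟨n, rfl, ⟨asIso (s ≫ biprod.snd)⟩⟩
      · have := hN.isIso_of_comp_ne_zero (S.brick_zero hR (n + 2)) h2
        exact Or.inl ⟨asIso (s ≫ biprod.fst)⟩
    · exfalso
      have h1 : i ≫ biprod.inl ≫ s + S.r n ≫ biprod.inr ≫ s = 𝟙 _ := by
        rw [← h, biprod.lift_eq, Preadditive.add_comp, Category.assoc, Category.assoc]
      have hb := S.brick_zero hR (n + 1)
      by_cases h2 : i ≫ biprod.inl ≫ s = 0
      · have h3 : S.r n ≫ biprod.inr ≫ s ≠ 0 := fun h3 => hb.id_ne_zero (by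
          rw [← h1, h2, h3, add_zero])
        exact S.not_isIso_r hR n (hb.isIso_of_comp_ne_zero (S.brick hR n (-D)) h3)
      · exact S.not_isIso_link hR (hb.isIso_of_comp_ne_zero (S.brick_zero hR (n + 2)) h2)

end SphereRay

end Arrows

section Vertices

variable {k : Type u} [Field k]
variable {C : Type u} [Category.{v} C] [Preadditive C] [HasZeroObject C] [HasShift C ℤ]
  [∀ n : ℤ, (shiftFunctor C n).Additive] [Pretriangulated C]
  [Linear k C] [HasFiniteBiproducts C] [∀ n : ℤ, Functor.Linear k (shiftFunctor C n)]

namespace SphereRay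

variable {R : C} {D : ℤ} (hR : IsSphereLike k R D) (S : SphereRay k R D)

/-- The shift `(X n)⟦i⟧`, as an indecomposable object. -/
def indecObj (i : ℤ) (n : ℕ) : IndecObj C (builtFrom R) :=
  ⟨(S.X n)⟦i⟧, (S.brick hR n i).mem, (S.brick hR n i).indec⟩

/-- The vertex of the Auslander-Reiten quiver given by `(X n)⟦i⟧`. -/
def vertex (i : ℤ) (n : ℕ) : ARVertex C (builtFrom R) := vertexOf C _ (S.indecObj hR i n)

theorem vertexOf_eq_vertex {M : IndecObj C (builtFrom R)} {i : ℤ} {n : ℕ}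
    (e : M.1 ≅ (S.X n)⟦i⟧) : vertexOf C _ M = S.vertex hR i n := Quotient.sound ⟨e⟩

theorem nonempty_iso_of_vertexOf_eq {M : IndecObj C (builtFrom R)} {i : ℤ} {n : ℕ}
    (h : vertexOf C _ M = S.vertex hR i n) : Nonempty (M.1 ≅ (S.X n)⟦i⟧) := Quotient.exact h

theorem vertex_inj {i j : ℤ} {n m : ℕ} (h : S.vertex hR i n = S.vertex hR j m) :
    i = j ∧ n = m := by
  obtain ⟨e⟩ := S.nonempty_iso_of_vertexOf_eq hR (M := S.indecObj hR i n) h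
  exact S.eq_of_iso hR e

theorem exists_eq_vertex (x : ARVertex C (builtFrom R)) : ∃ i n, S.vertex hR i n = x := by
  induction x using Quotient.inductionOn with
  | _ M =>
    obtain ⟨n, i, ⟨e⟩⟩ := S.nonempty_iso_of_indec hR M.2.1 M.2.2
    exact ⟨i, n, (S.vertexOf_eq_vertex hR e.symm).symm⟩

theorem vArrow_succ (i : ℤ) (n : ℕ) :
    VArrow C (builtFrom R) (S.vertex hR i n) (S.vertex hR i (n + 1)) := by
  obtain ⟨f, hf⟩ := S.exists_link hR n
  exact ⟨_, _, _, (S.irredMor_link hR hf).shift i, rfl, rfl⟩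

theorem vArrow_pred (i : ℤ) (n : ℕ) :
    VArrow C (builtFrom R) (S.vertex hR i (n + 1)) (S.vertex hR (i - D) n) :=
  ⟨S.indecObj hR i (n + 1), ⟨((S.X n)⟦-D⟧)⟦i⟧, ((S.brick hR n (-D)).shift i).mem,
    ((S.brick hR n (-D)).shift i).indec⟩, _, (S.irredMor_r hR n).shift i, rfl,
    S.vertexOf_eq_vertex hR (shiftShiftIso _ (by omega))⟩

theorem vArrow_iff {i j : ℤ} {n m : ℕ} :
    VArrow C (builtFrom R) (S.vertex hR i n) (S.vertex hR j m) ↔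
      (j = i ∧ m = n + 1) ∨ (j = i - D ∧ n = m + 1) := by
  constructor
  · rintro ⟨M, N, f, hf, hM, hN⟩
    obtain ⟨e⟩ := S.nonempty_iso_of_vertexOf_eq hR hM
    obtain ⟨e'⟩ := S.nonempty_iso_of_vertexOf_eq hR hN
    have hb : IsSerreBrick R D (N.1⟦-i⟧) :=
      (S.isSerreBrick_of_indec hR N.2.1 N.2.2).shift _
    let κ : S.X n ≅ M.1⟦-i⟧ := (shiftShiftNegIso (S.X n) (i := i) (j := -i) (by omega)).symm ≪≫
      (shiftFunctor C (-i)).mapIso e.symm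
    let κ' : N.1⟦-i⟧ ≅ (S.X m)⟦j - i⟧ := (shiftFunctor C (-i)).mapIso e' ≪≫
      shiftShiftIso _ (by omega)
    obtain ⟨⟨φ⟩⟩ | ⟨l, rfl, ⟨φ⟩⟩ := S.iso_of_irredMor hR hb ((hf.shift (-i)).iso_comp κ)
    · obtain ⟨h1, h2⟩ := S.eq_of_iso hR (κ'.symm ≪≫ φ ≪≫ (shiftZeroIso _).symm)
      omega
    · obtain ⟨h1, h2⟩ := S.eq_of_iso hR (κ'.symm ≪≫ φ)
      omega
  · rintro (⟨rfl, rfl⟩ | ⟨rfl, rfl⟩)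
    exacts [S.vArrow_succ hR _ _, S.vArrow_pred hR _ _]

theorem vmap_vertex (t : ARTranslation C (builtFrom R)) (i : ℤ) (n : ℕ) :
    t.vmap (S.vertex hR i n) = S.vertex hR (i + D) n := by
  obtain ⟨Y, f, g, h, T⟩ := t.triangle (S.indecObj hR i n)
  obtain ⟨e⟩ := (S.brick hR n i).nonempty_iso_of_isARTriangle T
  exact S.vertexOf_eq_vertex hR (e ≪≫ shiftShiftIso _ rfl)

theorem sameComponent_vertex_zero (i : ℤ) (n : ℕ) :
    sameComponent C (builtFrom R) (S.vertex hR i n) (S.vertex hR i 0) := by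
  induction n with
  | zero => exact .refl _
  | succ n ih => exact .trans _ _ _ (.rel _ _ (Or.inr (S.vArrow_succ hR i n))) ih

theorem sameComponent_add (i : ℤ) :
    sameComponent C (builtFrom R) (S.vertex hR (i + D) 0) (S.vertex hR i 0) := by
  have h := S.vArrow_pred hR (i + D) 0
  rw [add_sub_cancel_right] at h
  exact .trans _ _ _ (.rel _ _ (Or.inl (S.vArrow_succ hR (i + D) 0))) (.rel _ _ (Or.inl h))

theorem sameComponent_add_mul (i p : ℤ) :
    sameComponent C (builtFrom R) (S.vertex hR (i + p * D) 0) (S.vertex hR i 0) := by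
  induction p with
  | zero =>
    rw [zero_mul, add_zero]
    exact .refl _
  | succ p ih =>
    have h := S.sameComponent_add hR (i + p * D)
    rw [add_assoc, ← add_one_mul] at h
    exact .trans _ _ _ h ih
  | pred p ih =>
    have h := S.sameComponent_add hR (i + (-p - 1) * D)
    rw [add_assoc, ← add_one_mul, sub_add_cancel] at h
    exact .trans _ _ _ (.symm _ _ h) ih

theorem dvd_of_sameComponent {x y : ARVertex C (builtFrom R)}
    (h : sameComponent C (builtFrom R) x y) :
    ∀ {i j : ℤ} {n m : ℕ}, x = S.vertex hR i n → y = S.vertex hR j m → D ∣ i - j := by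
  induction h with
  | rel x y h =>
    rintro i j n m rfl rfl
    rw [S.vArrow_iff hR, S.vArrow_iff hR] at h
    obtain (⟨rfl, -⟩ | ⟨rfl, -⟩) | (⟨rfl, -⟩ | ⟨rfl, -⟩) := h <;> simp
  | refl x =>
    rintro i j n m rfl h
    simp [(S.vertex_inj hR h).1]
  | symm x y _ ih =>
    intro i j n m h h'
    rw [← neg_sub, dvd_neg]
    exact ih h' h
  | trans x y z _ _ ih ih' =>
    intro i j n m h h'
    obtain ⟨l, q, rfl⟩ := S.exists_eq_vertex hR y
    rw [← sub_add_sub_cancel i l j]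
    exact dvd_add (ih h rfl) (ih' rfl h')

theorem sameComponent_iff {i j : ℤ} {n m : ℕ} :
    sameComponent C (builtFrom R) (S.vertex hR i n) (S.vertex hR j m) ↔ D ∣ i - j := by
  refine ⟨fun h => S.dvd_of_sameComponent hR h rfl rfl, fun ⟨p, hp⟩ => ?_⟩
  obtain rfl : i = j + p * D := by rw [mul_comm, ← hp]; ring
  exact .trans _ _ _ (S.sameComponent_vertex_zero hR _ n) (.trans _ _ _
    (S.sameComponent_add_mul hR j p) (.symm _ _ (S.sameComponent_vertex_zero hR j m)))

include hR S in
theorem nonempty_components_equiv : Nonempty (ARComponents C (builtFrom R) ≃ Fin D.toNat) := by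
  have hD := hR.one_le
  let F : Fin D.toNat → ARComponents C (builtFrom R) := fun x => Quotient.mk _ (S.vertex hR x 0)
  refine ⟨(Equiv.ofBijective F ⟨fun x y h => ?_, fun c => ?_⟩).symm⟩
  · obtain ⟨q, hq⟩ := (S.sameComponent_iff hR).1 (Quotient.exact h)
    have hx := x.2
    have hy := y.2
    obtain hq' | rfl | hq' := lt_trichotomy q 0
    · have : D * q ≤ -D := by nlinarith
      omega
    · ext
      omega
    · have : D ≤ D * q := by nlinarith
      omega
  · induction c using Quotient.inductionOn with
    | _ x =>
      obtain ⟨i, n, rfl⟩ := S.exists_eq_vertex hR x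
      have h1 := Int.emod_nonneg i (by omega : D ≠ 0)
      have h2 := Int.emod_lt_of_pos i (by omega : 0 < D)
      refine ⟨⟨(i % D).toNat, by omega⟩, Quotient.sound ((S.sameComponent_iff hR).2 ?_)⟩
      rw [Int.toNat_of_nonneg h1, ← neg_sub, dvd_neg]
      exact Int.dvd_self_sub_emod

include hR S in
theorem isZAInftyComponent (t : ARTranslation C (builtFrom R)) (x₀ : ARVertex C (builtFrom R)) :
    IsZAInftyComponent C (builtFrom R) t.vmap (componentOf C (builtFrom R) x₀) := by
  have hD := hR.one_le
  obtain ⟨i₀, n₀, rfl⟩ := S.exists_eq_vertex hR x₀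
  let comp := componentOf C (builtFrom R) (S.vertex hR i₀ n₀)
  let F : ZAVertex → comp := fun x => ⟨S.vertex hR (i₀ + x.1 * D) (x.2 - 1 : ℕ),
    (S.sameComponent_iff hR).2 (by simp)⟩
  have hinj : Function.Injective F := fun x y h => by
    obtain ⟨h1, h2⟩ := S.vertex_inj hR (Subtype.ext_iff.1 h)
    have h3 : x.1 = y.1 := mul_right_cancel₀ (by omega : D ≠ 0) (add_left_cancel h1)
    have hx := x.2.pos
    have hy := y.2.pos
    exact Prod.ext h3 (PNat.eq (by omega))
  have hsurj : Function.Surjective F := fun ⟨x, hx⟩ => by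
    obtain ⟨i, n, rfl⟩ := S.exists_eq_vertex hR x
    obtain ⟨q, hq⟩ := (S.sameComponent_iff hR).1 hx
    refine ⟨(q, n.succPNat), Subtype.ext ?_⟩
    change S.vertex hR (i₀ + q * D) _ = _
    congr 1
    rw [mul_comm, ← hq]
    ring
  let E : ZAVertex ≃ comp := Equiv.ofBijective F ⟨hinj, hsurj⟩
  have hE : ∀ x, (E x).1 = S.vertex hR (i₀ + x.1 * D) (x.2 - 1 : ℕ) := fun _ => rfl
  have hτ : ∀ x : ZAVertex, t.vmap (E x).1 = (E (ZATrans x)).1 := fun x => by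
    rw [hE, hE, S.vmap_vertex hR, ZATrans, add_one_mul, add_assoc]
  refine ⟨fun x hx => ?_, E.symm, fun x y => ?_, fun x => ?_⟩
  · obtain ⟨x', hx'⟩ := E.surjective ⟨x, hx⟩
    obtain rfl : (E x').1 = x := congrArg Subtype.val hx'
    rw [hτ]
    exact (E _).2
  · obtain ⟨x, rfl⟩ := E.surjective x
    obtain ⟨y, rfl⟩ := E.surjective y
    rw [E.symm_apply_apply, E.symm_apply_apply, hE, hE, S.vArrow_iff hR, ZAArrow]
    have hx := x.2.pos
    have hy := y.2.pos
    have h1 : i₀ + y.1 * D = i₀ + x.1 * D ↔ y.1 = x.1 := by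
      rw [add_right_inj, mul_left_inj' (by omega)]
    have h2 : i₀ + y.1 * D = i₀ + x.1 * D - D ↔ y.1 = x.1 - 1 := by
      refine ⟨fun h ↦ mul_right_cancel₀ (by omega : D ≠ 0) ?_, fun h ↦ ?_⟩
      · linarith
      · rw [h]
        ring
    rw [h1, h2, ← PNat.coe_inj, ← PNat.coe_inj, PNat.add_coe, PNat.add_coe, PNat.one_coe]
    omega
  · obtain ⟨x, rfl⟩ := E.surjective x
    rw [E.symm_apply_apply, E.symm_apply_eq]
    exact Subtype.ext (hτ x)

end SphereRay

end Vertices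

section Statements

variable {k : Type u} [Field k]
variable {C : Type u} [Category.{v} C] [Preadditive C] [HasZeroObject C] [HasShift C ℤ]
  [∀ n : ℤ, (shiftFunctor C n).Additive] [Pretriangulated C]
  [Linear k C] [HasFiniteBiproducts C] [∀ n : ℤ, Functor.Linear k (shiftFunctor C n)]
variable {Co : Type u} [Category.{v} Co] [Preadditive Co] [HasZeroObject Co] [HasShift Co ℤ]
  [∀ n : ℤ, (shiftFunctor Co n).Additive] [Pretriangulated Co]
  [Linear k Co] [HasFiniteBiproducts Co] [∀ n : ℤ, Functor.Linear k (shiftFunctor Co n)]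
/-- If `dim_k H(R) = 2`, then `D^c(R)` has Auslander-Reiten triangles, and
the AR quiver of `D^c(R)` has exactly `d - 1` components, each isomorphic to `ℤA∞` as a
stable translation quiver. -/
theorem spheres_case (S : DGSetup k C Co) (h2 : S.dimH = 2) :
    HasARTriangles C S.Dc ∧
    Nonempty (ARComponents C S.Dc ≃ Fin (S.d - 1).toNat) ∧
    (∀ (t : ARTranslation C S.Dc) (v₀ : ARVertex C S.Dc),
      IsZAInftyComponent C S.Dc t.vmap (componentOf C S.Dc v₀)) := by
  have hR := S.isSphereLike h2
  obtain ⟨Y⟩ := hR.nonempty_sphereRay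
  exact ⟨Y.hasARTriangles hR, Y.nonempty_components_equiv hR,
    fun t v₀ ↦ Y.isZAInftyComponent hR t v₀⟩

end Statements
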